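/- Let K be a field of characteristic zero, let R be an associative unital K-algebra, let q ∈ K be nonzero and transcendental over ℚ (regarded as a central unit of R via the structure map), and suppose in addition that the ordered monomials t^r := ∏_{(i,j) ∈ [m]×[n], taken in lexicographic order} t_{i,j}^{r(i,j)}, for r ranging over all functions [m]×[n] → ℤ, are K-linearly independent in R. Let C be an m×n Cauchon diagram and let I ⊆ [m], J ⊆ [n] with |I| = |J| = k. Then det_q(M_C[I,J]) = 0 if and only if there does not exist a vertex-disjoint (R_I,C_J)-path system in the Cauchon graph G_C. -/

import Mathlib

universe u

/-- Quantum affine space data: a central unit `q` and units `t i j`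
satisfying the quantum affine space commutation relations. -/
structure QMData (R : Type u) [Ring R] (m n : ℕ) where
  q : Rˣ
  t : Fin m → Fin n → Rˣ
  q_central : ∀ r : R, (q : R) * r = r * (q : R)
  row_rel : ∀ (i : Fin m) ⦃j j' : Fin n⦄, j < j' →
    (t i j : R) * (t i j' : R) = (q : R) * ((t i j' : R) * (t i j : R))
  col_rel : ∀ ⦃i i' : Fin m⦄ (j : Fin n), i < i' →
    (t i j : R) * (t i' j : R) = (q : R) * ((t i' j : R) * (t i j : R))
  mixed_rel : ∀ ⦃i i' : Fin m⦄ ⦃j j' : Fin n⦄, i < i' → j ≠ j' →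
    (t i j : R) * (t i' j' : R) = (t i' j' : R) * (t i j : R)

/-- `white i j = true` means the square `(i,j)` is white.  The Cauchon
condition: for every black square, either every square above it or every
square to its left is also black. -/
def IsCauchon {m n : ℕ} (white : Fin m → Fin n → Bool) : Prop :=
  ∀ i j, white i j = false →
    (∀ i' : Fin m, i' < i → white i' j = false) ∨
    (∀ j' : Fin n, j' < j → white i j' = false)

/-- Vertices of the Cauchon graph: white squares, row vertices `r_i`,
column vertices `c_j`. -/
inductive CVertex (m n : ℕ) where
  | sq : Fin m → Fin n → CVertex m n
  | row : Fin m → CVertex m n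
  | col : Fin n → CVertex m n
deriving DecidableEq

/-- Directed edges of the Cauchon graph. -/
inductive CEdge {m n : ℕ} (white : Fin m → Fin n → Bool) :
    CVertex m n → CVertex m n → Prop where
  | fromRow (i : Fin m) (k : Fin n) :
      white i k = true → (∀ k' : Fin n, k < k' → white i k' = false) →
      CEdge white (.row i) (.sq i k)
  | toCol (i : Fin m) (j : Fin n) :
      white i j = true → (∀ i' : Fin m, i < i' → white i' j = false) →
      CEdge white (.sq i j) (.col j)
  | horiz (i : Fin m) (k j : Fin n) :
      j < k → white i k = true → white i j = true →
      (∀ j' : Fin n, j < j' → j' < k → white i j' = false) →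
      CEdge white (.sq i k) (.sq i j)
  | vert (i i' : Fin m) (j : Fin n) :
      i < i' → white i j = true → white i' j = true →
      (∀ l : Fin m, i < l → l < i' → white l j = false) →
      CEdge white (.sq i j) (.sq i' j)

/-- The weight of an edge of the Cauchon graph (1 on non-edges). -/
def wt {R : Type u} {m n : ℕ} [Ring R] (D : QMData R m n) :
    CVertex m n → CVertex m n → R
  | .row i, .sq i' k => if i = i' then (D.t i' k : R) else 1
  | .sq i k, .sq i' j =>
      if i = i' ∧ j < k then (↑((D.t i k)⁻¹) * ↑(D.t i j) : R) else 1
  | _, _ => 1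

/-- A pair of vertices spans a horizontal edge (edges from `r_i` are
horizontal; edges between squares are horizontal iff the rows agree). -/
def Horiz {m n : ℕ} : CVertex m n → CVertex m n → Prop
  | .row _, _ => True
  | .sq i _, .sq i' _ => i = i'
  | _, _ => False

/-- `l` is (the list of vertices of) a directed path from `u` to `v`. -/
def IsPathFrom {m n : ℕ} (white : Fin m → Fin n → Bool) (u v : CVertex m n)
    (l : List (CVertex m n)) : Prop :=
  l.Chain' (CEdge white) ∧ l.head? = some u ∧ l.getLast? = some v

/-- The list of (endpoint pairs of the) edges of a path. -/
def steps {m n : ℕ} (l : List (CVertex m n)) : List (CVertex m n × CVertex m n) :=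
  l.zip l.tail

/-- The weight of a path: the ordered product of its edge weights. -/
def pathWeight {R : Type u} {m n : ℕ} [Ring R] (D : QMData R m n)
    (l : List (CVertex m n)) : R :=
  ((steps l).map fun p => wt D p.1 p.2).prod

/-- The number of inversions (length) of a permutation of `Fin k`. -/
def invCount {k : ℕ} (σ : Equiv.Perm (Fin k)) : ℕ :=
  ((Finset.univ : Finset (Fin k × Fin k)).filter fun p => p.1 < p.2 ∧ σ p.2 < σ p.1).card

/-- The quantum determinant of a `k × k` matrix over a (noncommutative) ring. -/
def qdet {R : Type u} [Ring R] {k : ℕ} (q : Rˣ) (N : Matrix (Fin k) (Fin k) R) : R :=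
  ∑ σ : Equiv.Perm (Fin k),
    (-(q : R)) ^ invCount σ * ((List.finRange k).map fun i => N i (σ i)).prod

/-- The path matrix: entry `(i,j)` is the sum of the weights of all directed
paths from `r_i` to `c_j` (zero when there are none). -/
noncomputable def pathMatrix {R : Type u} {m n : ℕ} [Ring R] (D : QMData R m n)
    (white : Fin m → Fin n → Bool) : Matrix (Fin m) (Fin n) R :=
  Matrix.of fun i j =>
    ∑ᶠ p : {l : List (CVertex m n) // IsPathFrom white (.row i) (.col j) l},
      pathWeight D p.1

/-- An `(R_I, C_J)`-path system: paths `P ℓ : r_{i_ℓ} ⇒ c_{j_{σ ℓ}}`. -/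
structure PathSys {m n : ℕ} (white : Fin m → Fin n → Bool) {k : ℕ}
    (ι : Fin k → Fin m) (κ : Fin k → Fin n) where
  σ : Equiv.Perm (Fin k)
  P : Fin k → List (CVertex m n)
  isPath : ∀ l : Fin k, IsPathFrom white (.row (ι l)) (.col (κ (σ l))) (P l)

/-- A path system is vertex-disjoint if no two of its paths share a vertex. -/
def PathSys.VertexDisjoint {m n : ℕ} {white : Fin m → Fin n → Bool} {k : ℕ}
    {ι : Fin k → Fin m} {κ : Fin k → Fin n} (S : PathSys white ι κ) : Prop :=
  ∀ a b : Fin k, a ≠ b → ∀ x : CVertex m n, x ∈ S.P a → x ∈ S.P b → False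

/-- The weight of a path system: the ordered product `w(P₁)⋯w(P_k)`. -/
def PathSys.weight {R : Type u} {m n : ℕ} [Ring R] (D : QMData R m n)
    {white : Fin m → Fin n → Bool} {k : ℕ} {ι : Fin k → Fin m} {κ : Fin k → Fin n}
    (S : PathSys white ι κ) : R :=
  ((List.finRange k).map fun l => pathWeight D (S.P l)).prod

/-- The `q`-sign of a path system: `(-q) ^ ℓ(σ_P)`. -/
def PathSys.sgnq {R : Type u} {m n : ℕ} [Ring R] (D : QMData R m n)
    {white : Fin m → Fin n → Bool} {k : ℕ} {ι : Fin k → Fin m} {κ : Fin k → Fin n}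
    (S : PathSys white ι κ) : R :=
  (-(D.q : R)) ^ invCount S.σ

/-- The ordered monomial `t^r = ∏_{(i,j) lex} t_{i,j}^{r(i,j)}`. -/
def lexMonomial {R : Type u} [Ring R] {m n : ℕ} (D : QMData R m n)
    (r : Fin m × Fin n → ℤ) : R :=
  ((List.finRange m).map fun i =>
    ((List.finRange n).map fun j => ((D.t i j ^ r (i, j) : Rˣ) : R)).prod).prod

namespace CVertex

variable {m n : ℕ}

instance : Finite (CVertex m n) :=
  Finite.of_surjective
    (α := (Fin m × Fin n) ⊕ Fin m ⊕ Fin n)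
    (Sum.elim (fun p => CVertex.sq p.1 p.2) (Sum.elim CVertex.row CVertex.col))
    (fun v => match v with
      | .sq i j => ⟨.inl (i, j), rfl⟩
      | .row i => ⟨.inr (.inl i), rfl⟩
      | .col j => ⟨.inr (.inr j), rfl⟩)

noncomputable instance : Fintype (CVertex m n) := Fintype.ofFinite _

/-- The row of a vertex; column vertices are placed below the last row. -/
def level : CVertex m n → ℕ
  | .sq i _ => i
  | .row i => i
  | .col _ => m

/-- The column of a vertex; row vertices are placed to the right of the last column. -/
def column : CVertex m n → ℕ
  | .sq _ j => j
  | .row _ => n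
  | .col j => j

@[simp] theorem level_sq (i : Fin m) (j : Fin n) : (sq i j).level = i := rfl

@[simp] theorem level_row (i : Fin m) : (row i : CVertex m n).level = i := rfl

@[simp] theorem level_col (j : Fin n) : (col j : CVertex m n).level = m := rfl

@[simp] theorem column_sq (i : Fin m) (j : Fin n) : (sq i j).column = j := rfl

@[simp] theorem column_row (i : Fin m) : (row i : CVertex m n).column = n := rfl

/-- `u` comes before `v` when the diagram is scanned row by row from top to bottom, each row
from right to left. -/
def Before (u v : CVertex m n) : Prop :=
  u.level < v.level ∨ u.level = v.level ∧ v.column < u.column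

/-- A numerical measure that decreases along `Before`. -/
def depth (u : CVertex m n) : ℕ := (m - u.level) * (n + 1) + u.column

theorem level_le (u : CVertex m n) : u.level ≤ m := by
  cases u <;> simp only [level] <;> omega

theorem column_le (u : CVertex m n) : u.column ≤ n := by
  cases u <;> simp only [column] <;> omega

theorem ext_level_column {u v : CVertex m n} (h : u.level = v.level)
    (h' : u.column = v.column) : u = v := by
  cases u <;> cases v <;> simp only [level, column] at h h' <;>
    first
      | omega
      | (simp only [CVertex.sq.injEq, CVertex.row.injEq, CVertex.col.injEq, Fin.ext_iff]; omega)

theorem Before.depth_lt {u v : CVertex m n} (h : u.Before v) : v.depth < u.depth := by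
  have hu := u.level_le
  have hv := v.level_le
  have hu' := u.column_le
  have hv' := v.column_le
  unfold depth
  rcases h with h | ⟨h, h'⟩
  · obtain ⟨d, hd⟩ : ∃ d, m - u.level = (m - v.level) + 1 + d := ⟨v.level - u.level - 1, by omega⟩
    rw [hd]
    nlinarith [Nat.zero_le (d * (n + 1))]
  · rw [h]
    omega

theorem before_of_depth_le {u v : CVertex m n} (h : v.depth ≤ u.depth) (hne : u ≠ v) :
    u.Before v := by
  by_contra hb
  have : v.Before u := by
    unfold Before at hb ⊢
    have : ¬ (u.level = v.level ∧ u.column = v.column) := fun h => hne (ext_level_column h.1 h.2)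
    omega
  exact absurd this.depth_lt (by omega)

theorem Before.trans {u v w : CVertex m n} (h : u.Before v) (h' : v.Before w) : u.Before w := by
  unfold Before at *
  omega

theorem Before.ne {u v : CVertex m n} (h : u.Before v) : u ≠ v := by
  rintro rfl
  exact lt_irrefl _ h.depth_lt

instance : IsTrans (CVertex m n) Before := ⟨fun _ _ _ => Before.trans⟩

end CVertex

section Graph

variable {m n : ℕ} {white : Fin m → Fin n → Bool}

theorem CEdge.before {u v : CVertex m n} (h : CEdge white u v) : u.Before v := by
  cases h with
  | fromRow i k _ _ => exact .inr ⟨rfl, k.isLt⟩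
  | toCol i j _ _ => exact .inl i.isLt
  | horiz i k j hjk _ _ _ => exact .inr ⟨rfl, hjk⟩
  | vert i i' j hi _ _ _ => exact .inl hi

theorem CEdge.column_lt {u v : CVertex m n} (h : CEdge white u v) : v.column < n := by
  cases h <;> simp only [CVertex.column] <;> omega

open Classical in
/-- The out-neighbours of a vertex of the Cauchon graph. -/
noncomputable def outNbrs (white : Fin m → Fin n → Bool) (u : CVertex m n) :
    Finset (CVertex m n) :=
  Finset.univ.filter (CEdge white u)

theorem mem_outNbrs {u v : CVertex m n} : v ∈ outNbrs white u ↔ CEdge white u v := by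
  simp [outNbrs]

theorem IsPathFrom.before_or_eq {u v : CVertex m n} {l : List (CVertex m n)}
    (h : IsPathFrom white u v l) : ∀ x ∈ l, x = u ∨ u.Before x := by
  obtain ⟨hc, hh, -⟩ := h
  cases l with
  | nil => simp at hh
  | cons a l =>
    obtain rfl : a = u := by simpa using hh
    have := ((List.IsChain.imp (fun _ _ => CEdge.before) hc).pairwise)
    rw [List.pairwise_cons] at this
    intro x hx
    rcases List.mem_cons.1 hx with hx | hx
    · exact .inl hx
    · exact .inr (this.1 x hx)

theorem IsPathFrom.nodup {u v : CVertex m n} {l : List (CVertex m n)}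
    (h : IsPathFrom white u v l) : l.Nodup :=
  (List.IsChain.imp (fun _ _ => CEdge.before) h.1).pairwise.imp CVertex.Before.ne

theorem IsPathFrom.cons {u u' v : CVertex m n} {l : List (CVertex m n)} (he : CEdge white u u')
    (h : IsPathFrom white u' v l) : IsPathFrom white u v (u :: l) := by
  obtain ⟨hc, hh, hl⟩ := h
  refine ⟨List.isChain_cons.2 ⟨?_, hc⟩, rfl, ?_⟩
  · intro y hy
    rw [hh] at hy
    simpa using (Option.mem_some.1 hy) ▸ he
  · cases l with
    | nil => simp at hh
    | cons a l => simpa [List.getLast?_cons_cons] using hl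

theorem IsPathFrom.exists_cons {u v : CVertex m n} {l : List (CVertex m n)} (hne : u ≠ v)
    (h : IsPathFrom white u v l) :
    ∃ u' l', CEdge white u u' ∧ IsPathFrom white u' v l' ∧ l = u :: l' := by
  obtain ⟨hc, hh, hl⟩ := h
  match l, hc, hh, hl with
  | [], _, hh, _ => simp at hh
  | [a], _, hh, hl =>
    simp only [List.head?_cons, Option.some.injEq, List.getLast?_singleton] at hh hl
    exact absurd (hh.symm.trans hl) hne
  | a :: b :: l, hc, hh, hl =>
    obtain rfl : a = u := by simpa using hh
    obtain ⟨hab, hc⟩ := List.isChain_cons_cons.1 hc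
    exact ⟨b, b :: l, hab, ⟨hc, rfl, by simpa [List.getLast?_cons_cons] using hl⟩, rfl⟩

theorem isPathFrom_col_iff {j : Fin n} {v : CVertex m n} {l : List (CVertex m n)} :
    IsPathFrom white (.col j) v l ↔ v = .col j ∧ l = [.col j] := by
  constructor
  · intro h
    by_cases hv : CVertex.col j = v
    · subst hv
      obtain ⟨hc, hh, hl⟩ := h
      match l, hc, hh with
      | [], _, hh => simp at hh
      | [a], _, hh => simpa using hh
      | a :: b :: l, hc, hh =>
        obtain rfl : a = .col j := by simpa using hh
        cases (List.isChain_cons_cons.1 hc).1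
    · obtain ⟨u', -, he, -⟩ := h.exists_cons hv
      cases he
  · rintro ⟨rfl, rfl⟩
    exact ⟨List.isChain_singleton _, rfl, rfl⟩

theorem finite_setOf_isPathFrom (u v : CVertex m n) : {l | IsPathFrom white u v l}.Finite := by
  classical
  have : Finite {l : List (CVertex m n) | l.Nodup} :=
    inferInstanceAs (Finite {l : List (CVertex m n) // l.Nodup})
  exact (Set.toFinite {l : List (CVertex m n) | l.Nodup}).subset fun _ h => h.nodup

end Graph

section PathSum

variable {R : Type*} [Ring R] {m n : ℕ} {white : Fin m → Fin n → Bool}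

/-- The sum of the weights of all paths from `u` to the column vertex `c_j`. -/
noncomputable def pathSum (D : QMData R m n) (white : Fin m → Fin n → Bool) (u : CVertex m n)
    (j : Fin n) : R :=
  ∑ᶠ l ∈ {l | IsPathFrom white u (.col j) l}, pathWeight D l

theorem pathMatrix_apply (D : QMData R m n) (i : Fin m) (j : Fin n) :
    pathMatrix D white i j = pathSum D white (.row i) j :=
  finsum_set_coe_eq_finsum_mem {l | IsPathFrom white (.row i) (.col j) l}

theorem IsPathFrom.pathWeight_cons (D : QMData R m n) {u u' v : CVertex m n}
    {l : List (CVertex m n)} (h : IsPathFrom white u' v l) :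
    pathWeight D (u :: l) = wt D u u' * pathWeight D l := by
  cases l with
  | nil => simp [IsPathFrom] at h
  | cons a l =>
    obtain rfl : a = u' := by simpa using h.2.1
    simp [pathWeight, steps]

theorem pathSum_col (D : QMData R m n) (j l : Fin n) :
    pathSum D white (.col j) l = if l = j then 1 else 0 := by
  unfold pathSum
  simp only [isPathFrom_col_iff, CVertex.col.injEq]
  by_cases h : l = j
  · simp [h, pathWeight, steps]
  · simp [h]

theorem pathSum_eq_sum (D : QMData R m n) (u : CVertex m n) (j : Fin n) (hu : u ≠ .col j) :
    pathSum D white u j = ∑ v ∈ outNbrs white u, wt D u v * pathSum D white v j := by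
  have hset : {l | IsPathFrom white u (.col j) l} =
      ⋃ v ∈ (outNbrs white u : Set (CVertex m n)),
        List.cons u '' {l | IsPathFrom white v (.col j) l} := by
    ext l
    simp only [Set.mem_ofPred_eq, Set.mem_iUnion, Finset.mem_coe, mem_outNbrs, Set.mem_image,
      exists_prop]
    constructor
    · intro h
      obtain ⟨v, l', he, h', rfl⟩ := h.exists_cons hu
      exact ⟨v, he, l', h', rfl⟩
    · rintro ⟨v, he, l', h', rfl⟩
      exact h'.cons he
  unfold pathSum
  rw [hset, finsum_mem_biUnion, finsum_mem_coe_finset]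
  · refine Finset.sum_congr rfl fun v _ => ?_
    rw [finsum_mem_image List.cons_injective.injOn,
      mul_finsum_mem' _ _ (finite_setOf_isPathFrom _ _)]
    exact finsum_mem_congr rfl fun l hl => IsPathFrom.pathWeight_cons D hl
  · intro v _ v' _ hne
    refine Set.disjoint_left.2 ?_
    rintro _ ⟨l, hl, rfl⟩ ⟨l', hl', h⟩
    obtain rfl : l' = l := by simpa using h
    exact hne (Option.some_injective _ (hl.2.1.symm.trans hl'.2.1))
  · exact (outNbrs white u).finite_toSet
  · exact fun v _ => (finite_setOf_isPathFrom _ _).image _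

end PathSum

section Planarity

variable {m n : ℕ} {white : Fin m → Fin n → Bool}

/-- The squares among the admissible vertices are white. -/
def CVertex.IsAdmissible (white : Fin m → Fin n → Bool) : CVertex m n → Prop
  | .sq i j => white i j = true
  | _ => True

theorem CEdge.isAdmissible {u v : CVertex m n} (h : CEdge white u v) : v.IsAdmissible white := by
  cases h <;> first | assumption | trivial

/-- `x` lies in a column to the left of `y`, and if it is below `y` then the column of `x` crosses
the row of `y` on a vertical edge of the Cauchon graph that ends at `x`. -/
def LeftOf (white : Fin m → Fin n → Bool) (x y : CVertex m n) : Prop :=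
  x.column < y.column ∧ (y.level < x.level →
    (∀ (i : Fin m) (j : Fin n), (j : ℕ) = x.column → y.level ≤ i → (i : ℕ) < x.level →
      white i j = false) ∧
    ∃ (i : Fin m) (j : Fin n), (j : ℕ) = x.column ∧ (i : ℕ) < y.level ∧ white i j = true)

theorem CEdge.horizontal_or_vertical {u v : CVertex m n} (h : CEdge white u v) :
    (∃ i j, v = .sq i j ∧ white i j = true ∧ u.level = i ∧ (j : ℕ) < u.column ∧
      ∀ j' : Fin n, j < j' → (j' : ℕ) < u.column → white i j' = false) ∨
    ((∃ i j, u = .sq i j ∧ white i j = true) ∧ v.column = u.column ∧ u.level < v.level ∧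
      ∀ (i : Fin m) (j : Fin n), (j : ℕ) = u.column → u.level < i → (i : ℕ) < v.level →
        white i j = false) := by
  cases h with
  | fromRow i k hk h => exact .inl ⟨i, k, rfl, hk, rfl, k.isLt, fun j' hj _ => h j' hj⟩
  | toCol i j hw h =>
    refine .inr ⟨⟨i, j, rfl, hw⟩, rfl, i.isLt, fun i' j' hj hi _ => ?_⟩
    obtain rfl : j' = j := Fin.ext hj
    exact h i' hi
  | horiz i k j hjk _ hw h => exact .inl ⟨i, j, rfl, hw, rfl, hjk, fun j' hj hk => h j' hj hk⟩
  | vert i i' j hi hw _ h =>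
    refine .inr ⟨⟨i, j, rfl, hw⟩, rfl, hi, fun l j' hj hl hl' => ?_⟩
    obtain rfl : j' = j := Fin.ext hj
    exact h l hl hl'

theorem LeftOf.column_lt_of_horizontal (hC : IsCauchon white) {x y : CVertex m n}
    (h : LeftOf white x y) (hx : x.IsAdmissible white) (hb : y.Before x) {i : Fin m} {j : Fin n}
    (hw : white i j = true) (hi : y.level = i)
    (hblack : ∀ j' : Fin n, j < j' → (j' : ℕ) < y.column → white i j' = false)
    (hne : CVertex.sq i j ≠ x) : x.column < j := by
  obtain ⟨hcol, hcross⟩ := h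
  by_contra hlt
  have hyn := y.column_le
  have hle : y.level ≤ x.level := by
    unfold CVertex.Before at hb
    omega
  obtain ⟨l, hl⟩ : ∃ l : Fin n, (l : ℕ) = x.column := ⟨⟨x.column, by omega⟩, rfl⟩
  rcases hle.eq_or_lt with heq | hlt'
  · cases x with
    | row i' => simp only [CVertex.column_row] at hcol; omega
    | col j' => simp only [CVertex.level_col] at heq; omega
    | sq i' j' =>
      simp only [CVertex.level_sq, CVertex.column_sq] at heq hlt hcol
      obtain rfl : i' = i := by omega
      rcases (show (j : ℕ) ≤ j' by omega).eq_or_lt with h | h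
      · exact hne (by rw [Fin.ext h])
      · have := hblack j' h hcol
        rw [CVertex.IsAdmissible, this] at hx
        cases hx
  · obtain ⟨hno, i₀, l', hl', hi₀, hw₀⟩ := hcross hlt'
    obtain rfl : l' = l := Fin.ext (by omega)
    rcases (show (j : ℕ) ≤ l' by omega).eq_or_lt with h | h
    · obtain rfl : j = l' := Fin.ext h
      rw [hno i j hl (by omega) (by omega)] at hw
      cases hw
    · have hb : white i l' = false := hblack l' h (by omega)
      rcases hC i l' hb with habove | hleft
      · rw [habove i₀ (by omega)] at hw₀
        cases hw₀
      · rw [hleft j h] at hw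
        cases hw

theorem LeftOf.of_edge_right (hC : IsCauchon white) {x y y' : CVertex m n}
    (h : LeftOf white x y) (hx : x.IsAdmissible white) (hb : y.Before x)
    (he : CEdge white y y') (hne : y' ≠ x) : LeftOf white x y' := by
  rcases he.horizontal_or_vertical with ⟨i, j, rfl, hw, hi, hj, hblack⟩ | ⟨-, hcol, hlev, -⟩
  · refine ⟨h.column_lt_of_horizontal hC hx hb hw hi hblack hne, fun hlt => ?_⟩
    have := h.2 (hi ▸ hlt)
    rwa [hi] at this
  · refine ⟨hcol ▸ h.1, fun hlt => ?_⟩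
    obtain ⟨hno, i₀, l, hl, hi₀, hw₀⟩ := h.2 (hlev.trans hlt)
    exact ⟨fun i j hj hi hi' => hno i j hj (hlev.le.trans hi) hi', i₀, l, hl, hi₀.trans hlev, hw₀⟩

theorem LeftOf.of_edge_left {x x' y : CVertex m n} (h : LeftOf white x y) (hb : x.Before y)
    (he : CEdge white x x') : LeftOf white x' y := by
  have hcol := h.1
  have hlt : x.level < y.level := by
    unfold CVertex.Before at hb
    omega
  rcases he.horizontal_or_vertical with
    ⟨i, j, rfl, hw, hi, hj, -⟩ | ⟨⟨i, j, rfl, hw⟩, hcol', hlev, hblack⟩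
  · refine ⟨hj.trans hcol, fun hlt' => ?_⟩
    simp only [CVertex.level_sq] at hlt'
    omega
  · refine ⟨hcol' ▸ hcol, fun hlt' => ⟨fun i' j' hj' hi' hi'' => ?_, i, j, ?_, hlt, hw⟩⟩
    · exact hblack i' j' (by omega) (by omega) hi''
    · rw [hcol']
      rfl

theorem LeftOf.not_between (hC : IsCauchon white) {x y y' : CVertex m n}
    (h : LeftOf white x y) (h' : LeftOf white y' x) (hx : x.IsAdmissible white) (hb : y.Before x)
    (he : CEdge white y y') : False := by
  have hne : y' ≠ x := by
    rintro rfl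
    exact lt_irrefl _ h'.1
  exact lt_asymm h'.1 (h.of_edge_right hC hx hb he hne).1

end Planarity

section DisjointPaths

variable {m n k : ℕ} {white : Fin m → Fin n → Bool}

/-- There are pairwise vertex-disjoint paths from the vertices `u a` to the column vertices
indexed by `κ`, in some order. -/
def HasDisjointPaths (white : Fin m → Fin n → Bool) (κ : Fin k → Fin n)
    (u : Fin k → CVertex m n) : Prop :=
  ∃ (σ : Equiv.Perm (Fin k)) (P : Fin k → List (CVertex m n)),
    (∀ a, IsPathFrom white (u a) (.col (κ (σ a))) (P a)) ∧
      ∀ a b, a ≠ b → List.Disjoint (P a) (P b)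

theorem exists_vertexDisjoint_iff {ι : Fin k → Fin m} {κ : Fin k → Fin n} :
    (∃ S : PathSys white ι κ, S.VertexDisjoint) ↔
      HasDisjointPaths white κ fun a => .row (ι a) := by
  constructor
  · rintro ⟨⟨σ, P, hP⟩, hS⟩
    exact ⟨σ, P, hP, fun a b hab x hx hx' => hS a b hab x hx hx'⟩
  · rintro ⟨σ, P, hP, hS⟩
    exact ⟨⟨σ, P, hP⟩, fun a b hab x hx hx' => hS a b hab hx hx'⟩

theorem hasDisjointPaths_iff_exists_update {κ : Fin k → Fin n} {u : Fin k → CVertex m n}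
    {a : Fin k} (hcol : ∀ j, u a ≠ .col j) (hmin : ∀ b, b ≠ a → (u a).Before (u b)) :
    HasDisjointPaths white κ u ↔
      ∃ v ∈ outNbrs white (u a), HasDisjointPaths white κ (Function.update u a v) := by
  constructor
  · rintro ⟨σ, P, hP, hdisj⟩
    obtain ⟨v, l, he, hl, hPa⟩ := (hP a).exists_cons (hcol _)
    refine ⟨v, mem_outNbrs.2 he, σ, Function.update P a l, fun b => ?_, ?_⟩
    · by_cases hb : b = a
      · subst hb
        simpa using hl
      · simpa [hb] using hP b
    · have hsub : ∀ b, Function.update P a l b ⊆ P b := by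
        intro b
        by_cases hb : b = a
        · subst hb
          simp [hPa]
        · simp [hb]
      exact fun b c hbc x hx hx' => hdisj b c hbc (hsub b hx) (hsub c hx')
  · rintro ⟨v, hv, σ, P, hP, hdisj⟩
    have hPa : IsPathFrom white v (.col (κ (σ a))) (P a) := by simpa using hP a
    have hPb : ∀ b, b ≠ a → IsPathFrom white (u b) (.col (κ (σ b))) (P b) := fun b hb => by
      simpa [hb] using hP b
    have hnot : ∀ b, b ≠ a → u a ∉ P b := by
      intro b hb hx
      rcases (hPb b hb).before_or_eq _ hx with h | h
      · exact (hmin b hb).ne h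
      · exact ((hmin b hb).trans h).ne rfl
    refine ⟨σ, Function.update P a (u a :: P a), fun b => ?_, fun b c hbc => ?_⟩
    · by_cases hb : b = a
      · subst hb
        simpa using hPa.cons (mem_outNbrs.1 hv)
      · simpa [hb] using hPb b hb
    · by_cases hb : b = a
      · subst hb
        simpa [hbc.symm, List.disjoint_cons_left] using ⟨hnot c hbc.symm, hdisj b c hbc⟩
      · by_cases hc : c = a
        · subst hc
          simpa [hb, List.disjoint_cons_right] using ⟨hnot b hb, hdisj b c hbc⟩
        · simpa [hb, hc] using hdisj b c hbc

theorem hasDisjointPaths_col_iff {κ c : Fin k → Fin n} (hc : Function.Injective c) :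
    HasDisjointPaths white κ (fun a => (.col (c a) : CVertex m n)) ↔
      ∃ σ : Equiv.Perm (Fin k), c = κ ∘ σ := by
  simp only [HasDisjointPaths, isPathFrom_col_iff, CVertex.col.injEq]
  constructor
  · rintro ⟨σ, P, hP, -⟩
    exact ⟨σ, funext fun a => ((hP a).1).symm⟩
  · rintro ⟨σ, hσ⟩
    refine ⟨σ, fun a => [.col (c a)], fun a => ⟨(congrFun hσ a).symm, rfl⟩, fun a b hab => ?_⟩
    simpa using fun h => hab (hc h.symm)

theorem exists_perm_comp_iff {κ c : Fin k → Fin n}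
    (hc : Function.Injective c) :
    (∃ σ : Equiv.Perm (Fin k), c = κ ∘ σ) ↔
      Finset.univ.image c = Finset.univ.image κ := by
  constructor
  · rintro ⟨σ, rfl⟩
    ext j
    simp only [Finset.mem_image, Finset.mem_univ, true_and, Function.comp_apply]
    exact ⟨fun ⟨a, h⟩ => ⟨_, h⟩, fun ⟨a, h⟩ => ⟨σ.symm a, by simpa using h⟩⟩
  · intro h
    have hmem : ∀ a, ∃ b, κ b = c a := fun a => by
      have := Finset.mem_image_of_mem c (Finset.mem_univ a)
      rw [h] at this
      simpa using this
    choose σ hσ using hmem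
    have hinj : Function.Injective σ := fun a b hab => hc (by rw [← hσ, ← hσ, hab])
    exact ⟨Equiv.ofBijective σ (Finite.injective_iff_bijective.1 hinj),
      funext fun a => (hσ a).symm⟩

end DisjointPaths

section SkewCommute

variable {K A : Type*} [Field K] [Ring A] [Algebra K A]

/-- `a` and `b` commute up to the scalar `z`. -/
def SkewCommute (z : K) (a b : A) : Prop := a * b = z • (b * a)

namespace SkewCommute

variable {z z' : K} {a b c : A}

theorem one_left (a : A) : SkewCommute (1 : K) 1 a := by simp [SkewCommute]

theorem mul_left (h : SkewCommute z a c) (h' : SkewCommute z' b c) :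
    SkewCommute (z * z') (a * b) c := by
  unfold SkewCommute at *
  rw [mul_assoc, h', mul_smul_comm, ← mul_assoc, h, smul_mul_assoc, smul_smul, mul_assoc,
    mul_comm z']

theorem mul_right (h : SkewCommute z a b) (h' : SkewCommute z' a c) :
    SkewCommute (z * z') a (b * c) := by
  unfold SkewCommute at *
  rw [← mul_assoc, h, smul_mul_assoc, mul_assoc, h', mul_smul_comm, smul_smul, mul_assoc]

theorem symm (h : SkewCommute z a b) (hz : z ≠ 0) : SkewCommute z⁻¹ b a := by
  unfold SkewCommute at *
  rw [h, smul_smul, inv_mul_cancel₀ hz, one_smul]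

theorem units_inv_left {u : Aˣ} (h : SkewCommute z (u : A) b) (hz : z ≠ 0) :
    SkewCommute z⁻¹ (↑u⁻¹ : A) b := by
  unfold SkewCommute at *
  rw [← Units.mul_right_inj u, mul_smul_comm, Units.mul_inv_cancel_left, ← mul_assoc, h,
    smul_mul_assoc, Units.mul_inv_cancel_right, smul_smul, inv_mul_cancel₀ hz, one_smul]

theorem units_inv_right {u : Aˣ} (h : SkewCommute z b (u : A)) (hz : z ≠ 0) :
    SkewCommute z⁻¹ b (↑u⁻¹ : A) := by
  have := (h.symm hz).units_inv_left (inv_ne_zero hz)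
  rw [inv_inv] at this
  exact this.symm hz

theorem sum_left {ι : Type*} {s : Finset ι} {f : ι → A}
    (h : ∀ i ∈ s, SkewCommute z (f i) b) : SkewCommute z (∑ i ∈ s, f i) b := by
  unfold SkewCommute at *
  rw [Finset.sum_mul, Finset.mul_sum, Finset.smul_sum]
  exact Finset.sum_congr rfl h

theorem sum_right {ι : Type*} {s : Finset ι} {f : ι → A}
    (h : ∀ i ∈ s, SkewCommute z a (f i)) : SkewCommute z a (∑ i ∈ s, f i) := by
  unfold SkewCommute at *
  rw [Finset.sum_mul, Finset.mul_sum, Finset.smul_sum]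
  exact Finset.sum_congr rfl h

end SkewCommute

end SkewCommute

section PathOp

variable {K A : Type*} [Field K] [Ring A] [Algebra K A] {m n : ℕ}
  {white : Fin m → Fin n → Bool}

/-- Elements `x j` generating a quantum exterior algebra and commuting with the generators
`t i l` of a quantum affine space up to powers of `q`. -/
structure IsQuantumExterior (D : QMData A m n) (q : K) (x : Fin n → A) : Prop where
  q_ne_zero : q ≠ 0
  q_eq : (D.q : A) = algebraMap K A q
  mul_self : ∀ j, x j * x j = 0
  skew : ∀ ⦃j j'⦄, j < j' → SkewCommute (-q) (x j') (x j)
  t_skew : ∀ i j l, SkewCommute (if j = l then q⁻¹ else 1) (D.t i j : A) (x l)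

/-- The generating element `∑ₗ w(u, c_l) x_l` of the path sums starting at `u`. -/
noncomputable def pathOp (D : QMData A m n) (white : Fin m → Fin n → Bool) (x : Fin n → A)
    (u : CVertex m n) : A :=
  ∑ l, pathSum D white u l * x l

theorem pathOp_col (D : QMData A m n) (x : Fin n → A) (j : Fin n) :
    pathOp D white x (.col j) = x j := by
  simp [pathOp, pathSum_col]

theorem pathOp_eq_sum (D : QMData A m n) (x : Fin n → A) {u : CVertex m n}
    (hu : ∀ j, u ≠ .col j) :
    pathOp D white x u = ∑ v ∈ outNbrs white u, wt D u v * pathOp D white x v := by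
  simp only [pathOp, Finset.mul_sum]
  rw [Finset.sum_comm]
  refine Finset.sum_congr rfl fun l _ => ?_
  rw [pathSum_eq_sum D u l (hu l), Finset.sum_mul]
  exact Finset.sum_congr rfl fun v _ => mul_assoc _ _ _

theorem CEdge.wt_cases (D : QMData A m n) {i : Fin m} {j : Fin n} {v : CVertex m n}
    (h : CEdge white (.sq i j) v) :
    (∃ l, l < j ∧ v = .sq i l ∧ wt D (.sq i j) v = ↑(D.t i j)⁻¹ * ↑(D.t i l)) ∨
      (v.column = j ∧ (i : ℕ) < v.level ∧ wt D (.sq i j) v = 1) := by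
  cases h with
  | toCol _ _ _ _ => exact .inr ⟨rfl, i.isLt, rfl⟩
  | horiz _ _ l hl _ _ _ => exact .inl ⟨l, hl, rfl, by simp [wt, hl]⟩
  | vert _ i' _ hi _ _ _ => exact .inr ⟨rfl, hi, by simp [wt]⟩

theorem CEdge.eq_of_level_eq {u v w : CVertex m n} (hv : CEdge white u v) (hw : CEdge white u w)
    (h : u.level = v.level ↔ u.level = w.level) : v = w := by
  have hbv := hv.before
  have hbw := hw.before
  have hav := hv.isAdmissible
  have haw := hw.isAdmissible
  rcases hv.horizontal_or_vertical with ⟨i, j, rfl, hwv, hi, hj, hbl⟩ | ⟨-, hc, hl, hbl⟩ <;>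
  rcases hw.horizontal_or_vertical with ⟨i', j', rfl, hww, hi', hj', hbl'⟩ | ⟨-, hc', hl', hbl'⟩
  · obtain rfl : i = i' := Fin.ext (hi.symm.trans hi')
    rcases lt_trichotomy j j' with hlt | heq | hlt
    · rw [hbl j' hlt hj'] at hww
      cases hww
    · rw [heq]
    · rw [hbl' j hlt hj] at hwv
      cases hwv
  · simp only [CVertex.level_sq, hi, true_iff] at h
    omega
  · simp only [CVertex.level_sq, hi', iff_true] at h
    omega
  · refine CVertex.ext_level_column ?_ (hc.trans hc'.symm)
    by_contra hne
    rcases lt_or_gt_of_ne hne with hlt | hlt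
    · cases v with
      | sq i j =>
        have := hbl' i j hc hl hlt
        rw [CVertex.IsAdmissible, this] at hav
        cases hav
      | row i =>
        have := w.level_le
        have := hv.column_lt
        simp at this
      | col j =>
        have := w.level_le
        simp only [CVertex.level_col] at hlt
        omega
    · cases w with
      | sq i j =>
        have := hbl i j hc' hl' hlt
        rw [CVertex.IsAdmissible, this] at haw
        cases haw
      | row i =>
        have := hw.column_lt
        simp at this
      | col j =>
        have := v.level_le
        simp only [CVertex.level_col] at hlt
        omega

namespace IsQuantumExterior

variable {D : QMData A m n} {q : K} {x : Fin n → A}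

theorem t_skew_row (hx : IsQuantumExterior D q x) (i : Fin m) {j l : Fin n} (h : j < l) :
    SkewCommute q (D.t i j : A) (D.t i l) := by
  rw [SkewCommute, D.row_rel i h, hx.q_eq, Algebra.smul_def]

theorem t_skew_of_lt (hx : IsQuantumExterior D q x) {i i' : Fin m} (h : i < i') (j l : Fin n) :
    SkewCommute (if j = l then q else 1) (D.t i j : A) (D.t i' l) := by
  split_ifs with hjl
  · subst hjl
    rw [SkewCommute, D.col_rel j h, hx.q_eq, Algebra.smul_def]
  · rw [SkewCommute, D.mixed_rel h hjl, one_smul]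

theorem t_skew_pathOp (hx : IsQuantumExterior D q x) (i : Fin m) (j : Fin n) (u : CVertex m n)
    (hu : u.column < n)
    (h : (i : ℕ) < u.level ∨ (i : ℕ) = u.level ∧ u.column ≤ j) :
    SkewCommute (if (j : ℕ) = u.column then q⁻¹ else 1) (D.t i j : A)
      (pathOp D white x u) := by
  have hq := hx.q_ne_zero
  induction hd : u.depth using Nat.strong_induction_on generalizing u with
  | _ d ih =>
    cases u with
    | row i' => simp at hu
    | col l =>
      have := hx.t_skew i j l
      simp only [Fin.ext_iff] at this
      rw [pathOp_col]
      exact this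
    | sq i' l =>
      rw [pathOp_eq_sum D x (by simp)]
      refine SkewCommute.sum_right fun v hv => ?_
      have he := mem_outNbrs.1 hv
      have ihv := fun h => ih v.depth (hd ▸ he.before.depth_lt) v he.column_lt h rfl
      simp only [CVertex.level_sq, CVertex.column_sq] at h
      change SkewCommute (if (j : ℕ) = l then q⁻¹ else 1) _ _
      rcases he.wt_cases D with ⟨l', hl', rfl, hw⟩ | ⟨hc, hlev, hw⟩
      · rw [hw]
        have ihv := ihv (by
          simp only [CVertex.level_sq, CVertex.column_sq]
          omega)
        change SkewCommute (if (j : ℕ) = l' then q⁻¹ else 1) _ _ at ihv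
        rcases h with h | ⟨h, h'⟩
        · have h1 := (hx.t_skew_of_lt h j l).units_inv_right (by split_ifs <;> simp [hq])
          have h2 := hx.t_skew_of_lt h j l'
          convert (h1.mul_right h2).mul_right ihv using 1
          simp only [Fin.ext_iff]
          split_ifs <;> simp [hq]
        · obtain rfl : i = i' := Fin.ext h
          have h2 := (hx.t_skew_row i (show l' < j from lt_of_lt_of_le hl' h')).symm hq
          have hne : (j : ℕ) ≠ l' := by omega
          rw [if_neg hne] at ihv
          rcases (show (l : ℕ) ≤ j from h').eq_or_lt with hlj | hlj
          · obtain rfl : l = j := Fin.ext hlj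
            have h1 : SkewCommute (1 : K) (D.t i l : A) ↑(D.t i l)⁻¹ := by simp [SkewCommute]
            convert (h1.mul_right h2).mul_right ihv using 1
            simp
          · have h1 := ((hx.t_skew_row i (show l < j from hlj)).symm hq).units_inv_right
              (inv_ne_zero hq)
            convert (h1.mul_right h2).mul_right ihv using 1
            rw [if_neg (by omega)]
            simp [hq]
      · rw [hw, one_mul]
        have ihv := ihv (.inl (by omega))
        rwa [hc] at ihv

theorem wt_commute_pathOp (hx : IsQuantumExterior D q x)
    {u v y : CVertex m n} (he : CEdge white u v) (hu : u.column < n) (hy : y.column < n)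
    (h : (u.level < y.level ∧ y.column ≠ u.column ∧ y.column ≠ v.column) ∨
      (u.level = y.level ∧ y.column < u.column ∧ y.column < v.column)) :
    SkewCommute (1 : K) (wt D u v) (pathOp D white x y) := by
  cases u with
  | row i => simp at hu
  | col j => cases he
  | sq i j =>
    simp only [CVertex.level_sq, CVertex.column_sq] at h
    rcases he.wt_cases D with ⟨l, hl, rfl, hw⟩ | ⟨-, -, hw⟩
    · simp only [CVertex.column_sq] at h
      have h1 := hx.t_skew_pathOp (white := white) i j y hy (by omega)
      have h2 := hx.t_skew_pathOp (white := white) i l y hy (by omega)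
      rw [if_neg (by omega)] at h1 h2
      rw [hw]
      convert (h1.units_inv_left one_ne_zero).mul_left h2 using 1
      simp
    · rw [hw]
      exact .one_left _

theorem pathOp_skew_and_mul_self (hx : IsQuantumExterior D q x) (hC : IsCauchon white)
    (u v : CVertex m n) (hu : u.column < n) (hv : v.column < n) (hau : u.IsAdmissible white)
    (hav : v.IsAdmissible white) :
    (LeftOf white u v → SkewCommute (-q) (pathOp D white x v) (pathOp D white x u)) ∧
      (u = v → pathOp D white x u * pathOp D white x u = 0) := by
  have hq := hx.q_ne_zero
  induction hd : u.depth + v.depth using Nat.strong_induction_on generalizing u v with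
  | _ d ih =>
  refine ⟨fun hl => ?_, ?_⟩
  · have hcol := hl.1
    rcases le_or_gt v.level u.level with hle | hlt
    · by_cases hvc : ∃ j, v = .col j
      · obtain ⟨j', rfl⟩ := hvc
        cases u with
        | col j => simpa [pathOp_col] using hx.skew (show j < j' from hcol)
        | row i => simp at hu
        | sq i j =>
          simp only [CVertex.level_col, CVertex.level_sq] at hle
          omega
      · rw [pathOp_eq_sum D x (u := v) (by simpa using hvc)]
        refine SkewCommute.sum_left fun w hw => ?_
        have he := mem_outNbrs.1 hw
        have hdw := he.before.depth_lt
        have hb : v.Before u := by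
          unfold CVertex.Before
          omega
        by_cases hwu : w = u
        · subst hwu
          have hsq := (ih _ (by omega) w w hu hu hau hau rfl).2 rfl
          rw [SkewCommute, mul_assoc, hsq, mul_zero]
          cases v with
          | row i => simp at hv
          | col j => cases he
          | sq i j =>
            rcases he.wt_cases D with ⟨l, hlj, rfl, hw⟩ | ⟨hc, hlev, hw⟩
            · have h1 := hx.t_skew_pathOp (white := white) i j (.sq i l) hu (.inr ⟨rfl, hlj.le⟩)
              have h2 := hx.t_skew_pathOp (white := white) i l (.sq i l) hu (.inr ⟨rfl, le_rfl⟩)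
              have h3 := (((h1.units_inv_left (by split_ifs <;> simp [hq])).mul_left h2).symm
                (by split_ifs <;> simp [hq]))
              rw [hw, ← mul_assoc, h3, smul_mul_assoc, mul_assoc, hsq, mul_zero, smul_zero,
                smul_zero]
            · simp only [CVertex.column_sq] at hcol
              omega
        · have hl' := hl.of_edge_right hC hau hb he hwu
          have h2 := (ih _ (by omega) u w hu he.column_lt hau he.isAdmissible rfl).1 hl'
          have h1 := hx.wt_commute_pathOp he hv hu (by
            have := hl'.1
            omega)
          simpa using h1.mul_left h2
    · have hb : u.Before v := .inl hlt
      by_cases huc : ∃ j, u = .col j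
      · obtain ⟨j, rfl⟩ := huc
        have := v.level_le
        simp only [CVertex.level_col] at hlt
        omega
      · rw [pathOp_eq_sum D x (u := u) (by simpa using huc)]
        refine SkewCommute.sum_right fun w hw => ?_
        have he := mem_outNbrs.1 hw
        have hdw := he.before.depth_lt
        have hl' := hl.of_edge_left hb he
        have h2 := (ih _ (by omega) w v he.column_lt hv he.isAdmissible hav rfl).1 hl'
        have h1 := hx.wt_commute_pathOp he hu hv (by
            have := hl'.1
            omega)
        simpa using (h1.symm one_ne_zero).mul_right h2
  · rintro rfl
    by_cases huc : ∃ j, u = .col j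
    · obtain ⟨j, rfl⟩ := huc
      rw [pathOp_col, hx.mul_self]
    · have ihe : ∀ v w, CEdge white u v → CEdge white u w →
          (LeftOf white v w → SkewCommute (-q) (pathOp D white x w) (pathOp D white x v)) ∧
          (v = w → pathOp D white x v * pathOp D white x v = 0) := fun v w hv hw =>
        ih _ (by have := hv.before.depth_lt; have := hw.before.depth_lt; omega) v w hv.column_lt
          hw.column_lt hv.isAdmissible hw.isAdmissible rfl
      cases u with
      | col j => simp at huc
      | row i => simp at hu
      | sq i j =>
      have hcancel : ∀ (l : Fin n) (w : CVertex m n), l < j → w.column = j → (i : ℕ) < w.level →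
          CEdge white (.sq i j) (.sq i l) → CEdge white (.sq i j) w →
          ((↑(D.t i j)⁻¹ * ↑(D.t i l)) * pathOp D white x (.sq i l)) * pathOp D white x w +
          pathOp D white x w * ((↑(D.t i j)⁻¹ * ↑(D.t i l)) * pathOp D white x (.sq i l)) = 0 := by
        intro l w hlj hwc hwl hel hew
        have hlw : LeftOf white (.sq i l) w :=
          ⟨by rw [hwc]; exact hlj, fun h => absurd h (by simp only [CVertex.level_sq]; omega)⟩
        have hsk := (ihe _ _ hel hew).1 hlw
        have h1 := hx.t_skew_pathOp (white := white) i j w hew.column_lt (.inl hwl)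
        have h2 := hx.t_skew_pathOp (white := white) i l w hew.column_lt (.inl hwl)
        rw [if_pos hwc.symm] at h1
        rw [if_neg (by omega)] at h2
        have h3 := (((h1.units_inv_left (inv_ne_zero hq)).mul_left h2).symm (by simp [hq]))
        have h4 := h3.mul_right hsk
        rw [SkewCommute] at h4
        rw [h4]
        simp [hq]
      have hself : ∀ v, CEdge white (.sq i j) v →
          (wt D (.sq i j) v * pathOp D white x v) *
            (wt D (.sq i j) v * pathOp D white x v) = 0 := by
        intro v he
        have hsq := (ihe v v he he).2 rfl
        rcases he.wt_cases D with ⟨l, hlj, rfl, hw⟩ | ⟨hc, hlev, hw⟩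
        · have h1 := hx.t_skew_pathOp (white := white) i j (.sq i l) he.column_lt
            (.inr ⟨rfl, hlj.le⟩)
          have h2 := hx.t_skew_pathOp (white := white) i l (.sq i l) he.column_lt
            (.inr ⟨rfl, le_rfl⟩)
          have h3 := (((h1.units_inv_left (by split_ifs <;> simp [hq])).mul_left h2).symm
            (by split_ifs <;> simp [hq]))
          rw [hw, mul_assoc, ← mul_assoc (pathOp D white x _), h3, smul_mul_assoc, mul_assoc _ _
            (pathOp D white x _), hsq, mul_zero, smul_zero, mul_zero]
        · rw [hw, one_mul, hsq]
      rw [pathOp_eq_sum D x (by simp), Finset.sum_mul_sum, ← Finset.sum_product']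
      refine Finset.sum_involution (fun p _ => p.swap) ?_ ?_ ?_ ?_
      · rintro ⟨v, w⟩ hvw
        rw [Finset.mem_product, mem_outNbrs, mem_outNbrs] at hvw
        obtain ⟨hev, hew⟩ := hvw
        simp only at hev hew
        simp only [Prod.swap_prod_mk]
        rcases hev.wt_cases D with ⟨l, hlj, rfl, hwv⟩ | ⟨hc, hlev, hwv⟩ <;>
        rcases hew.wt_cases D with ⟨l', hlj', rfl, hww⟩ | ⟨hc', hlev', hww⟩
        · have := hev.eq_of_level_eq hew (by simp)
          rw [← this, hself _ hev, add_zero]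
        · rw [hwv, hww, one_mul]
          exact hcancel l w hlj hc' hlev' hev hew
        · rw [hwv, hww, one_mul, add_comm]
          exact hcancel l' v hlj' hc hlev hew hev
        · have := hev.eq_of_level_eq hew (by simp only [CVertex.level_sq]; omega)
          rw [← this, hself _ hev, add_zero]
      · rintro ⟨v, w⟩ hvw hne heq
        rw [Finset.mem_product, mem_outNbrs, mem_outNbrs] at hvw
        obtain rfl : w = v := (Prod.mk.inj heq).1
        exact hne (hself _ hvw.1)
      · rintro ⟨v, w⟩ hvw
        simpa [and_comm] using hvw
      · exact fun _ _ => rfl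

end IsQuantumExterior

end PathOp

section ExteriorOperators

variable {K R : Type*} [Field K] [Ring R] [Algebra K R] {m n k : ℕ}
  {white : Fin m → Fin n → Bool}

/-- Left multiplication by `∑ₗ aₗ eₗ` in the quantum exterior algebra with generators `eₗ` and
coefficients in `R`; the function `f` stands for `∑_S f(S) e_S`. -/
def creationOp (q : K) (a : Fin n → R) : Module.End K (Finset (Fin n) → R) where
  toFun f S := ∑ l ∈ S, (-q) ^ (S.filter (· < l)).card • (a l * f (S.erase l))
  map_add' f g := by
    funext S
    simp [mul_add, Finset.sum_add_distrib]
  map_smul' c f := by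
    funext S
    simp [Finset.smul_sum, smul_comm c]

theorem creationOp_apply (q : K) (a : Fin n → R) (f : Finset (Fin n) → R) (S : Finset (Fin n)) :
    creationOp q a f S = ∑ l ∈ S, (-q) ^ (S.filter (· < l)).card • (a l * f (S.erase l)) := rfl

theorem creationOp_single_apply (q : K) (l : Fin n) (f : Finset (Fin n) → R)
    (S : Finset (Fin n)) :
    creationOp q (Pi.single l 1) f S =
      if l ∈ S then (-q) ^ (S.filter (· < l)).card • f (S.erase l) else 0 := by
  rw [creationOp_apply]
  split_ifs with h
  · rw [Finset.sum_eq_single_of_mem l h fun l' _ hne => by simp [hne]]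
    simp
  · exact Finset.sum_eq_zero fun l' hl' => by
      have : l' ≠ l := fun h' => h (h' ▸ hl')
      simp [this]

/-- The scalar by which `t i j` is rescaled on the component indexed by `S`, for `j` the column
of the vertex. -/
def CVertex.scale (q : K) (S : Finset (Fin n)) : CVertex m n → K
  | .sq _ j => if j ∈ S then 1 else q
  | .row _ => 1
  | .col j => if j ∈ S then 1 else q

theorem CVertex.scale_ne_zero {q : K} (hq : q ≠ 0) (S : Finset (Fin n)) (u : CVertex m n) :
    u.scale q S ≠ 0 := by
  cases u <;> simp only [CVertex.scale] <;> first | split_ifs <;> simp [hq] | simp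

theorem CVertex.scale_eq_zpow (q : K) (S : Finset (Fin n)) (u : CVertex m n) :
    ∃ e : ℤ, u.scale q S = q ^ e := by
  cases u <;> simp only [CVertex.scale]
  · split_ifs
    exacts [⟨0, by simp⟩, ⟨1, by simp⟩]
  · exact ⟨0, by simp⟩
  · split_ifs
    exacts [⟨0, by simp⟩, ⟨1, by simp⟩]

/-- The action of a tuple of units by pointwise left multiplication. -/
def diagUnit (K : Type*) [Field K] [Algebra K R] (d : Finset (Fin n) → Rˣ) :
    (Module.End K (Finset (Fin n) → R))ˣ :=
  Units.map (Algebra.lmul K (Finset (Fin n) → R)).toMonoidHom (MulEquiv.piUnits.symm d)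

theorem diagUnit_apply (d : Finset (Fin n) → Rˣ) (f : Finset (Fin n) → R) (S : Finset (Fin n)) :
    (diagUnit K d : Module.End K (Finset (Fin n) → R)) f S = d S * f S := rfl

/-- The action of the quantum affine space on the quantum exterior algebra. -/
def QMData.onExterior (D : QMData R m n) (q : K) (hq : (D.q : R) = algebraMap K R q) :
    QMData (Module.End K (Finset (Fin n) → R)) m n where
  q := diagUnit K fun _ => D.q
  t i j := diagUnit K fun S => if j ∈ S then D.t i j else D.q * D.t i j
  q_central T := by
    ext f S
    have h : ((diagUnit K fun _ => D.q : (Module.End K (Finset (Fin n) → R))ˣ) :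
        Module.End K (Finset (Fin n) → R)) = algebraMap K _ q := by
      ext f S
      simp [diagUnit_apply, hq, Algebra.smul_def]
    rw [h, Algebra.commutes]
  row_rel i j j' h := by
    have := D.row_rel i h
    refine LinearMap.ext fun f => funext fun S => ?_
    simp only [Module.End.mul_apply, diagUnit_apply]
    split_ifs <;> simp [hq, ← Algebra.smul_def, ← mul_assoc, this]
  col_rel i i' j h := by
    have := D.col_rel j h
    refine LinearMap.ext fun f => funext fun S => ?_
    simp only [Module.End.mul_apply, diagUnit_apply]
    split_ifs <;> simp [hq, ← Algebra.smul_def, ← mul_assoc, this]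
  mixed_rel i i' j j' h h' := by
    have := D.mixed_rel h h'
    refine LinearMap.ext fun f => funext fun S => ?_
    simp only [Module.End.mul_apply, diagUnit_apply]
    split_ifs <;> simp [hq, ← Algebra.smul_def, ← mul_assoc, this]

namespace QMData

variable (D : QMData R m n) (q : K) (hq : (D.q : R) = algebraMap K R q)

theorem onExterior_t_apply (i : Fin m) (j : Fin n) (f : Finset (Fin n) → R)
    (S : Finset (Fin n)) :
    ((D.onExterior q hq).t i j : Module.End K (Finset (Fin n) → R)) f S =
      (if j ∈ S then 1 else q) • (D.t i j * f S) := by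
  change ((if j ∈ S then D.t i j else D.q * D.t i j : Rˣ) : R) * f S = _
  split_ifs <;> simp [hq, ← Algebra.smul_def]

theorem onExterior_t_inv_apply (i : Fin m) (j : Fin n) (f : Finset (Fin n) → R)
    (S : Finset (Fin n)) :
    (↑((D.onExterior q hq).t i j)⁻¹ : Module.End K (Finset (Fin n) → R)) f S =
      (if j ∈ S then 1 else q)⁻¹ • (↑(D.t i j)⁻¹ * f S) := by
  change (↑(if j ∈ S then D.t i j else D.q * D.t i j : Rˣ)⁻¹ : R) * f S = _
  split_ifs with h
  · simp
  · have hinv : (↑D.q⁻¹ : R) = algebraMap K R q⁻¹ := by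
      rcases eq_or_ne q 0 with rfl | h0
      · have : (0 : R) = 1 := by rw [← D.q.inv_mul, hq, map_zero, mul_zero]
        rw [← mul_one (algebraMap K R _), ← this, mul_zero, ← mul_one (↑D.q⁻¹ : R), ← this,
          mul_zero]
      · rw [Units.inv_eq_of_mul_eq_one_right]
        rw [hq, ← map_mul, mul_inv_cancel₀ h0, map_one]
    rw [mul_inv_rev, Units.val_mul, hinv, ← Algebra.commutes, ← Algebra.smul_def, smul_mul_assoc]

theorem isQuantumExterior_onExterior (hq0 : q ≠ 0) :
    IsQuantumExterior (D.onExterior q hq) q fun l => creationOp q (Pi.single l (1 : R)) where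
  q_ne_zero := hq0
  q_eq := by
    ext f S
    simp [onExterior, diagUnit_apply, hq, Algebra.smul_def]
  mul_self j := by
    refine LinearMap.ext fun f => funext fun S => ?_
    simp [creationOp_single_apply]
  skew j j' h := by
    refine LinearMap.ext fun f => funext fun S => ?_
    simp only [Module.End.mul_apply, creationOp_single_apply, LinearMap.smul_apply, Pi.smul_apply,
      Finset.mem_erase, Finset.erase_right_comm (a := j) (b := j')]
    by_cases hj : j ∈ S <;> by_cases hj' : j' ∈ S <;> simp only [hj, hj', h.ne, h.ne', ne_eq,
      not_false_eq_true, and_self, and_false, if_true, if_false, smul_zero]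
    rw [smul_smul, smul_smul, smul_smul, mul_assoc, ← pow_add, ← pow_add, ← pow_succ']
    congr 2
    have h1 : (S.erase j').filter (· < j) = S.filter (· < j) := by
      ext l
      simp only [Finset.mem_filter, Finset.mem_erase]
      constructor
      · tauto
      · exact fun hl => ⟨⟨(hl.2.trans h).ne, hl.1⟩, hl.2⟩
    have h2 : (S.erase j).filter (· < j') = (S.filter (· < j')).erase j := by
      ext l
      simp only [Finset.mem_filter, Finset.mem_erase]
      tauto
    have h3 : j ∈ S.filter (· < j') := Finset.mem_filter.2 ⟨hj, h⟩
    have h4 := Finset.card_erase_add_one h3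
    rw [h1, h2]
    omega
  t_skew i j l := by
    refine LinearMap.ext fun f => funext fun S => ?_
    simp only [Module.End.mul_apply, creationOp_single_apply, LinearMap.smul_apply, Pi.smul_apply,
      onExterior_t_apply, Finset.mem_erase]
    by_cases hl : l ∈ S
    · by_cases hjl : j = l
      · subst hjl
        simp [hl, smul_smul, hq0, mul_comm]
      · simp [hl, hjl, smul_smul, mul_comm]
    · simp [hl]

theorem wt_onExterior_apply (hq0 : q ≠ 0) {u v : CVertex m n} (h : CEdge white u v)
    (f : Finset (Fin n) → R) (S : Finset (Fin n)) :
    (wt (D.onExterior q hq) u v) f S =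
      ((u.scale q S)⁻¹ * v.scale q S) • (wt D u v * f S) := by
  have hs := CVertex.scale_ne_zero hq0 S u
  cases h with
  | fromRow i l _ _ => simp [wt, onExterior_t_apply, CVertex.scale]
  | toCol i j _ _ =>
    have : (CVertex.col j : CVertex m n).scale q S = (CVertex.sq i j : CVertex m n).scale q S :=
      rfl
    rw [this, inv_mul_cancel₀ hs]
    simp [wt]
  | horiz i l j hjl _ _ _ =>
    simp [wt, hjl, onExterior_t_apply, onExterior_t_inv_apply, CVertex.scale, smul_smul,
      mul_assoc]
  | vert i i' j hi _ _ _ =>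
    have : (CVertex.sq i' j : CVertex m n).scale q S = (CVertex.sq i j : CVertex m n).scale q S :=
      rfl
    rw [this, inv_mul_cancel₀ hs]
    simp [wt]

theorem pathOp_onExterior_apply (hq0 : q ≠ 0) (u : CVertex m n) (f : Finset (Fin n) → R)
    (S : Finset (Fin n)) :
    pathOp (D.onExterior q hq) white (fun l => creationOp q (Pi.single l 1)) u f S =
      (u.scale q S)⁻¹ • creationOp q (pathSum D white u) f S := by
  induction hd : u.depth using Nat.strong_induction_on generalizing u with
  | _ d ih =>
  by_cases hu : ∃ j, u = .col j
  · obtain ⟨j, rfl⟩ := hu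
    have : pathSum D white (.col j) = Pi.single j 1 := by
      funext l
      simp [pathSum_col, Pi.single_apply]
    rw [pathOp_col, this, creationOp_single_apply]
    by_cases hj : j ∈ S <;> simp [CVertex.scale, hj]
  · have hu : ∀ j, u ≠ .col j := by simpa using hu
    rw [pathOp_eq_sum _ _ hu, LinearMap.sum_apply, Finset.sum_apply]
    have hcr : creationOp q (pathSum D white u) f S =
        ∑ v ∈ outNbrs white u, wt D u v * creationOp q (pathSum D white v) f S := by
      simp only [creationOp_apply, Finset.mul_sum]
      rw [Finset.sum_comm]
      refine Finset.sum_congr rfl fun l _ => ?_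
      simp only [pathSum_eq_sum D u l (hu l), Finset.sum_mul, Finset.smul_sum, mul_smul_comm,
        mul_assoc]
    rw [hcr, Finset.smul_sum]
    refine Finset.sum_congr rfl fun v hv => ?_
    have he := mem_outNbrs.1 hv
    rw [Module.End.mul_apply, D.wt_onExterior_apply q hq hq0 he, ih _ (hd ▸ he.before.depth_lt) v
      rfl, mul_smul_comm, smul_smul, mul_assoc, mul_inv_cancel₀ (CVertex.scale_ne_zero hq0 S v),
      mul_one]

theorem pathOp_onExterior_row (hq0 : q ≠ 0) (i : Fin m) :
    pathOp (D.onExterior q hq) white (fun l => creationOp q (Pi.single l 1)) (.row i) =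
      creationOp q (pathMatrix D white i) := by
  refine LinearMap.ext fun f => funext fun S => ?_
  rw [pathOp_onExterior_apply _ _ _ hq0]
  have : pathMatrix D white i = pathSum D white (.row i) := funext fun j => pathMatrix_apply D i j
  simp [CVertex.scale, this]

end QMData

end ExteriorOperators

section QuantumDeterminant

variable {K R : Type*} [Field K] [Ring R] [Algebra K R] {m n k : ℕ}

/-- The number of inversions of a word. -/
def wordInv (c : Fin k → Fin n) : ℕ :=
  ((Finset.univ : Finset (Fin k × Fin k)).filter fun p => p.1 < p.2 ∧ c p.2 < c p.1).card

theorem wordInv_cons (l : Fin n) (c : Fin k → Fin n) :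
    wordInv (Fin.cons l c : Fin (k + 1) → Fin n) =
      (Finset.univ.filter fun a => c a < l).card + wordInv c := by
  simp only [wordInv, Finset.card_filter, Fintype.sum_prod_type, Fin.sum_univ_succ]
  simp

theorem wordInv_of_strictMono {c : Fin k → Fin n} (hc : StrictMono c) : wordInv c = 0 := by
  rw [wordInv, Finset.card_eq_zero, Finset.filter_eq_empty_iff]
  exact fun p _ h => lt_asymm h.2 (hc h.1)

theorem wordInv_comp {κ : Fin k → Fin n} (hκ : StrictMono κ) (σ : Equiv.Perm (Fin k)) :
    wordInv (κ ∘ σ) = invCount σ := by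
  simp only [wordInv, invCount, Function.comp_apply, hκ.lt_iff_lt]

theorem injective_cons_and_image_eq_iff (l : Fin n) (c : Fin k → Fin n) (S : Finset (Fin n)) :
    (Function.Injective (Fin.cons l c : Fin (k + 1) → Fin n) ∧
        Finset.univ.image (Fin.cons l c : Fin (k + 1) → Fin n) = S) ↔
      l ∈ S ∧ Function.Injective c ∧ Finset.univ.image c = S.erase l := by
  rw [Fin.cons_injective_iff]
  have himg : Finset.univ.image (Fin.cons l c : Fin (k + 1) → Fin n) =
      insert l (Finset.univ.image c) := by
    ext j
    simp [Fin.exists_fin_succ, eq_comm]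
  have hmem : l ∈ Set.range c ↔ l ∈ Finset.univ.image c := by simp
  rw [himg, hmem]
  constructor
  · rintro ⟨⟨hl, hc⟩, rfl⟩
    exact ⟨Finset.mem_insert_self _ _, hc, (Finset.erase_insert hl).symm⟩
  · rintro ⟨hl, hc, h⟩
    rw [h]
    exact ⟨⟨Finset.notMem_erase _ _, hc⟩, Finset.insert_erase hl⟩

open Classical in
theorem prod_creationOp_apply (q : K) (N : Fin k → Fin n → R) (S : Finset (Fin n)) :
    ((List.finRange k).map fun a => creationOp q (N a)).prod (Pi.single ∅ 1) S =
      ∑ c : Fin k → Fin n, if Function.Injective c ∧ Finset.univ.image c = S then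
        (-q) ^ wordInv c • ((List.finRange k).map fun a => N a (c a)).prod else 0 := by
  induction k generalizing S with
  | zero =>
    simp [Pi.single_apply, wordInv, eq_comm, Function.injective_of_subsingleton]
  | succ k ih =>
    rw [← (Fin.consEquiv fun _ => Fin n).sum_comp, Fintype.sum_prod_type, List.finRange_succ,
      List.map_cons, List.prod_cons, Module.End.mul_apply, creationOp_apply, List.map_map,
      ← Finset.univ_inter S, ← Finset.sum_ite_mem]
    refine Finset.sum_congr rfl fun l _ => ?_
    have hcons (c : Fin k → Fin n) :
        (Fin.consEquiv fun _ => Fin n) (l, c) = (Fin.cons l c : Fin (k + 1) → Fin n) := rfl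
    simp only [hcons, Finset.univ_inter, injective_cons_and_image_eq_iff]
    by_cases hl : l ∈ S
    · have := ih (fun a => N a.succ) (S.erase l)
      simp only [Function.comp_def, hl, if_true, true_and, this, Finset.mul_sum, Finset.smul_sum]
      refine Finset.sum_congr rfl fun c _ => ?_
      split_ifs with h
      · have hcard : (Finset.univ.filter fun a => c a < l).card = (S.filter (· < l)).card := by
          rw [← Finset.card_image_of_injective _ h.1]
          congr 1
          rw [← Finset.filter_image (p := (· < l)), h.2]
          ext j
          simp only [Finset.mem_filter, Finset.mem_erase]
          exact ⟨fun h => ⟨h.1.2, h.2⟩, fun h => ⟨⟨h.2.ne, h.1⟩, h.2⟩⟩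
        rw [wordInv_cons, hcard, pow_add, mul_smul, mul_smul_comm]
        simp [Function.comp_def]
      · simp
    · simp [hl]

theorem prod_creationOp_apply_eq_qdet {D : QMData R m n} {q : K}
    (hq : (D.q : R) = algebraMap K R q) (N : Fin k → Fin n → R) {κ : Fin k → Fin n}
    (hκ : StrictMono κ) :
    ((List.finRange k).map fun a => creationOp q (N a)).prod (Pi.single ∅ 1)
        (Finset.univ.image κ) =
      qdet D.q (Matrix.of fun a b => N a (κ b)) := by
  classical
  rw [prod_creationOp_apply, ← Finset.sum_filter, qdet]
  symm
  refine Finset.sum_bij (fun σ _ => κ ∘ σ) (fun σ _ => ?_) (fun σ _ τ _ h => ?_) (fun c hc => ?_)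
    (fun σ _ => ?_)
  · have hinj : Function.Injective (κ ∘ σ) := hκ.injective.comp σ.injective
    exact Finset.mem_filter.2 ⟨Finset.mem_univ _, hinj, (exists_perm_comp_iff hinj).1 ⟨σ, rfl⟩⟩
  · exact Equiv.ext fun a => hκ.injective (congrFun h a)
  · obtain ⟨-, hinj, himg⟩ := Finset.mem_filter.1 hc
    obtain ⟨σ, hσ⟩ := (exists_perm_comp_iff hinj).2 himg
    exact ⟨σ, Finset.mem_univ _, hσ.symm⟩
  · rw [wordInv_comp hκ, Algebra.smul_def, map_pow, map_neg, hq]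
    simp

theorem prod_creationOp_single_apply (q : K) {c : Fin k → Fin n} (hc : StrictMono c)
    (S : Finset (Fin n)) :
    ((List.finRange k).map fun a => creationOp q (Pi.single (c a) (1 : R))).prod (Pi.single ∅ 1) S =
      if Finset.univ.image c = S then 1 else 0 := by
  classical
  rw [prod_creationOp_apply, Finset.sum_eq_single c]
  · simp [hc.injective, wordInv_of_strictMono hc]
  · intro c' _ hne
    obtain ⟨a, ha⟩ := Function.ne_iff.1 hne
    split_ifs
    · rw [List.prod_eq_zero, smul_zero]
      exact List.mem_map.2 ⟨a, List.mem_finRange a, by simp [ha]⟩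
    · rfl
  · simp

end QuantumDeterminant

section OrderedMonomials

theorem zpow_mul_prod_map_zpow {G α : Type*} [Group G] [DecidableEq α] {t : α → G}
    (ht : ∀ a b, Commute (t a) (t b)) {p : α} (s : ℤ) (r : α → ℤ) {L : List α} (hL : L.Nodup)
    (hp : p ∈ L) :
    t p ^ s * (L.map fun a => t a ^ r a).prod =
      (L.map fun a => t a ^ (r a + (Pi.single p s : α → ℤ) a)).prod := by
  induction L with
  | nil => simp at hp
  | cons b L ih =>
    rw [List.nodup_cons] at hL
    simp only [List.map_cons, List.prod_cons]
    by_cases hb : b = p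
    · subst hb
      rw [← mul_assoc, ← zpow_add, add_comm s, Pi.single_eq_same]
      congr 2
      refine List.map_congr_left fun a ha => ?_
      rw [Pi.single_eq_of_ne (ne_of_mem_of_not_mem ha hL.1), add_zero]
    · rw [← mul_assoc, ((ht p b).zpow_zpow s (r b)).eq, mul_assoc,
        ih hL.2 ((List.mem_cons.1 hp).resolve_left (Ne.symm hb)), Pi.single_eq_of_ne hb, add_zero]

theorem exists_zpow_mul_prod_map_zpow {G α : Type*} [Group G] [DecidableEq α] {z : G}
    (hz : ∀ g, Commute z g) {t : α → G} (ht : ∀ a b, ∃ e : ℤ, t a * t b = z ^ e * (t b * t a))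
    {p : α} (s : ℤ) (r : α → ℤ) {L : List α} (hL : L.Nodup) (hp : p ∈ L) :
    ∃ e : ℤ, t p ^ s * (L.map fun a => t a ^ r a).prod =
      z ^ e * (L.map fun a => t a ^ (r a + (Pi.single p s : α → ℤ) a)).prod := by
  have hN : (Subgroup.zpowers z).Normal := ⟨by
    rintro _ ⟨e, rfl⟩ g
    refine ⟨e, ?_⟩
    simp only
    rw [← ((hz g).zpow_left e).eq, mul_inv_cancel_right]⟩
  let π := QuotientGroup.mk' (Subgroup.zpowers z)
  have hπz (e : ℤ) : π (z ^ e) = 1 := by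
    rw [← MonoidHom.mem_ker, QuotientGroup.ker_mk']
    exact ⟨e, rfl⟩
  have hcomm (a b : α) : Commute (π (t a)) (π (t b)) := by
    obtain ⟨e, he⟩ := ht a b
    rw [Commute, SemiconjBy, ← map_mul, he, map_mul, hπz, one_mul, map_mul]
  have h := zpow_mul_prod_map_zpow hcomm s r hL hp
  have hmap (r' : α → ℤ) : (L.map fun a => π (t a) ^ r' a).prod =
      π (L.map fun a => t a ^ r' a).prod := by
    rw [map_list_prod, List.map_map]
    simp [Function.comp_def]
  rw [hmap, hmap (fun a => r a + (Pi.single p s : α → ℤ) a), ← map_zpow, ← map_mul, eq_comm] at h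
  obtain ⟨e, he⟩ := QuotientGroup.eq.1 h
  refine ⟨e, ?_⟩
  rw [((hz _).zpow_left e).eq]
  exact eq_mul_of_inv_mul_eq he.symm

end OrderedMonomials

section PositiveCone

open Polynomial

/-- The field elements `c` such that `q ^ N * c` is a polynomial in `q` with natural
coefficients. -/
def positiveLaurent {K : Type*} [Field K] (q : K) : Set K :=
  {c | ∃ (N : ℕ) (p : ℕ[X]), q ^ N * c = aeval q p}

namespace positiveLaurent

variable {K : Type*} [Field K] {q : K}

theorem zero_mem : (0 : K) ∈ positiveLaurent q := ⟨0, 0, by simp⟩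

theorem zpow_mem (hq : q ≠ 0) (e : ℤ) : q ^ e ∈ positiveLaurent q := by
  refine ⟨(-e).toNat, X ^ e.toNat, ?_⟩
  rw [map_pow, aeval_X, ← zpow_natCast, ← zpow_natCast, ← zpow_add₀ hq]
  congr 1
  omega

theorem add_mem {c d : K} (hc : c ∈ positiveLaurent q) (hd : d ∈ positiveLaurent q) :
    c + d ∈ positiveLaurent q := by
  obtain ⟨N, p, hp⟩ := hc
  obtain ⟨N', p', hp'⟩ := hd
  refine ⟨N + N', p * X ^ N' + p' * X ^ N, ?_⟩
  simp only [map_add, map_mul, map_pow, aeval_X, ← hp, ← hp']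
  ring

theorem eq_zero_of_add_eq_zero [CharZero K] (hq : Transcendental ℚ q) {c d : K}
    (hc : c ∈ positiveLaurent q) (hd : d ∈ positiveLaurent q) (h : c + d = 0) : c = 0 := by
  have hq0 : q ≠ 0 := by
    rintro rfl
    exact hq isAlgebraic_zero
  obtain ⟨N, p, hp⟩ := hc
  obtain ⟨N', p', hp'⟩ := hd
  have haeval : aeval q (p * X ^ N' + p' * X ^ N) = 0 := by
    simp only [map_add, map_mul, map_pow, aeval_X, ← hp, ← hp']
    linear_combination q ^ N * q ^ N' * h
  rw [← aeval_map_algebraMap ℚ] at haeval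
  have hzero := transcendental_iff.1 hq _ haeval
  rw [Polynomial.map_eq_zero_iff (algebraMap ℕ ℚ).injective_nat] at hzero
  have hX : p * X ^ N' = 0 := by
    ext k
    have := congrArg (coeff · k) hzero
    simp only [coeff_add, coeff_zero] at this ⊢
    omega
  have : p = 0 := by
    ext k
    simpa [coeff_mul_X_pow] using congrArg (coeff · (k + N')) hX
  rw [this, map_zero] at hp
  exact (mul_eq_zero.1 hp).resolve_left (pow_ne_zero _ hq0)

end positiveLaurent

namespace QMData

variable {K R : Type*} [Field K] [Ring R] [Algebra K R] {m n : ℕ} (D : QMData R m n)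

/-- The group generated by `q` and the `t i j`. -/
def monomialGroup : Subgroup Rˣ :=
  Subgroup.closure (insert D.q (Set.range fun p : Fin m × Fin n => D.t p.1 p.2))

theorem q_mem_monomialGroup : D.q ∈ D.monomialGroup :=
  Subgroup.subset_closure (Set.mem_insert _ _)

theorem t_mem_monomialGroup (i : Fin m) (j : Fin n) : D.t i j ∈ D.monomialGroup :=
  Subgroup.subset_closure (Set.mem_insert_of_mem _ ⟨(i, j), rfl⟩)

/-- The sums of elements of the group generated by `q` and the `t i j`. -/
def positiveCone : AddSubmonoid R :=
  AddSubmonoid.closure (Units.val '' (D.monomialGroup : Set Rˣ))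

theorem mul_mem_positiveCone {g : Rˣ} (hg : g ∈ D.monomialGroup) {x : R}
    (hx : x ∈ D.positiveCone) : ↑g * x ∈ D.positiveCone := by
  induction hx using AddSubmonoid.closure_induction with
  | mem x hx =>
    obtain ⟨h, hh, rfl⟩ := hx
    exact AddSubmonoid.subset_closure ⟨g * h, mul_mem hg hh, rfl⟩
  | zero => simp
  | add x y _ _ hx hy => simpa [mul_add] using add_mem hx hy

theorem one_mem_positiveCone : (1 : R) ∈ D.positiveCone :=
  AddSubmonoid.subset_closure ⟨1, one_mem _, rfl⟩

/-- The ordered monomial as a unit. -/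
def lexUnit (r : Fin m × Fin n → ℤ) : Rˣ :=
  ((List.finRange m ×ˢ List.finRange n).map fun p => D.t p.1 p.2 ^ r p).prod

theorem val_lexUnit (r : Fin m × Fin n → ℤ) : (D.lexUnit r : R) = lexMonomial D r := by
  have h : ((D.lexUnit r : Rˣ) : R) = Units.coeHom R (D.lexUnit r) := rfl
  rw [h, lexUnit, map_list_prod, List.map_map]
  change (List.map _ (List.product _ _)).prod = _
  rw [List.product, List.map_flatMap, List.flatMap, List.prod_flatten, List.map_map, lexMonomial]
  simp [Function.comp_def]

theorem exists_t_mul_t_eq (p p' : Fin m × Fin n) :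
    ∃ e : ℤ, D.t p.1 p.2 * D.t p'.1 p'.2 = D.q ^ e * (D.t p'.1 p'.2 * D.t p.1 p.2) := by
  wlog h : p.1 < p'.1 ∨ p.1 = p'.1 ∧ p.2 ≤ p'.2 generalizing p p'
  · obtain ⟨e, he⟩ := this p' p (by omega)
    exact ⟨-e, by rw [he, zpow_neg, inv_mul_cancel_left]⟩
  obtain ⟨i, j⟩ := p
  obtain ⟨i', j'⟩ := p'
  simp only at h ⊢
  rcases h with h | ⟨rfl, h⟩
  · by_cases hj : j = j'
    · subst hj
      exact ⟨1, Units.ext (by simpa using D.col_rel j h)⟩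
    · exact ⟨0, Units.ext (by simpa using D.mixed_rel h hj)⟩
  · rcases h.eq_or_lt with rfl | h
    · exact ⟨0, by simp⟩
    · exact ⟨1, Units.ext (by simpa using D.row_rel i h)⟩

theorem exists_eq_zpow_mul_lexUnit {g : Rˣ} (hg : g ∈ D.monomialGroup) :
    ∃ (e : ℤ) (r : Fin m × Fin n → ℤ), g = D.q ^ e * D.lexUnit r := by
  have hz (g : Rˣ) : Commute D.q g := Units.ext (D.q_central g)
  have key (x : Rˣ) (hx : x ∈ insert D.q (Set.range fun p : Fin m × Fin n => D.t p.1 p.2)) (s : ℤ)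
      (y : Rˣ) (hy : ∃ (e : ℤ) (r : Fin m × Fin n → ℤ), y = D.q ^ e * D.lexUnit r) :
      ∃ (e : ℤ) (r : Fin m × Fin n → ℤ), x ^ s * y = D.q ^ e * D.lexUnit r := by
    obtain ⟨e, r, rfl⟩ := hy
    rcases hx with rfl | ⟨p, rfl⟩
    · exact ⟨s + e, r, by rw [zpow_add, mul_assoc]⟩
    · obtain ⟨e', he'⟩ := exists_zpow_mul_prod_map_zpow hz D.exists_t_mul_t_eq s r
        ((List.nodup_finRange m).product (List.nodup_finRange n))
        (List.mem_product.2 ⟨List.mem_finRange p.1, List.mem_finRange p.2⟩ :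
          p ∈ List.finRange m ×ˢ List.finRange n)
      refine ⟨e + e', fun a => r a + (Pi.single p s : Fin m × Fin n → ℤ) a, ?_⟩
      rw [← mul_assoc, ← ((hz _).zpow_left e).eq, mul_assoc, lexUnit, he', zpow_add, mul_assoc]
      rfl
  refine Subgroup.closure_induction_left (p := fun g _ =>
    ∃ (e : ℤ) (r : Fin m × Fin n → ℤ), g = D.q ^ e * D.lexUnit r) ⟨0, 0, by simp [lexUnit]⟩
    (fun x hx y _ hy => by simpa using key x hx 1 y hy)
    (fun x hx y _ hy => by simpa using key x hx (-1) y hy) hg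

variable {D} {q : K}

theorem val_zpow_q_mul (hq : (D.q : R) = algebraMap K R q) (hq0 : q ≠ 0) (e : ℤ) (x : R) :
    ↑(D.q ^ e) * x = q ^ e • x := by
  have : D.q = Units.map (algebraMap K R : K →* R) (Units.mk0 q hq0) := Units.ext hq
  rw [this, ← map_zpow, Algebra.smul_def, Units.coe_map, Units.val_zpow_eq_zpow_val, Units.val_mk0]
  rfl

theorem smul_mem_positiveCone (hq : (D.q : R) = algebraMap K R q) (hq0 : q ≠ 0) (e : ℤ) {x : R}
    (hx : x ∈ D.positiveCone) : q ^ e • x ∈ D.positiveCone := by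
  rw [← val_zpow_q_mul hq hq0]
  exact D.mul_mem_positiveCone (zpow_mem D.q_mem_monomialGroup e) hx

theorem exists_linearCombination_of_mem_positiveCone (hq : (D.q : R) = algebraMap K R q)
    (hq0 : q ≠ 0) {x : R} (hx : x ∈ D.positiveCone) :
    ∃ f : (Fin m × Fin n → ℤ) →₀ K, (∀ r, f r ∈ positiveLaurent q) ∧
      Finsupp.linearCombination K (lexMonomial D) f = x := by
  classical
  induction hx using AddSubmonoid.closure_induction with
  | mem x hx =>
    obtain ⟨g, hg, rfl⟩ := hx
    obtain ⟨e, r, rfl⟩ := D.exists_eq_zpow_mul_lexUnit hg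
    refine ⟨Finsupp.single r (q ^ e), fun r' => ?_, ?_⟩
    · rw [Finsupp.single_apply]
      split_ifs
      · exact positiveLaurent.zpow_mem hq0 e
      · exact positiveLaurent.zero_mem
    · rw [Finsupp.linearCombination_single, Units.val_mul, val_zpow_q_mul hq hq0, val_lexUnit]
  | zero => exact ⟨0, fun r => positiveLaurent.zero_mem, map_zero _⟩
  | add x y _ _ hx hy =>
    obtain ⟨f, hf, rfl⟩ := hx
    obtain ⟨g, hg, rfl⟩ := hy
    exact ⟨f + g, fun r => positiveLaurent.add_mem (hf r) (hg r), map_add _ _ _⟩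

theorem eq_zero_of_add_eq_zero_of_mem_positiveCone [CharZero K] (hq : (D.q : R) = algebraMap K R q)
    (hqtr : Transcendental ℚ q) (hlin : LinearIndependent K (lexMonomial D)) {x y : R}
    (hx : x ∈ D.positiveCone) (hy : y ∈ D.positiveCone) (h : x + y = 0) : x = 0 := by
  have hq0 : q ≠ 0 := by
    rintro rfl
    exact hqtr isAlgebraic_zero
  obtain ⟨f, hf, rfl⟩ := exists_linearCombination_of_mem_positiveCone hq hq0 hx
  obtain ⟨g, hg, rfl⟩ := exists_linearCombination_of_mem_positiveCone hq hq0 hy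
  rw [← map_add] at h
  have hfg := linearIndependent_iff.1 hlin _ h
  have : f = 0 := Finsupp.ext fun r =>
    positiveLaurent.eq_zero_of_add_eq_zero hqtr (hf r) (hg r) (DFunLike.congr_fun hfg r)
  rw [this, map_zero]

theorem sum_mem_positiveCone_ne_zero_iff [CharZero K] (hq : (D.q : R) = algebraMap K R q)
    (hqtr : Transcendental ℚ q) (hlin : LinearIndependent K (lexMonomial D)) {ι : Type*}
    {s : Finset ι} {f : ι → R} (hf : ∀ i ∈ s, f i ∈ D.positiveCone) :
    ∑ i ∈ s, f i ≠ 0 ↔ ∃ i ∈ s, f i ≠ 0 := by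
  classical
  refine ⟨Finset.exists_ne_zero_of_sum_ne_zero, ?_⟩
  rintro ⟨i, hi, hne⟩ h
  rw [← Finset.add_sum_erase s f hi] at h
  exact hne (eq_zero_of_add_eq_zero_of_mem_positiveCone hq hqtr hlin (hf i hi)
    (sum_mem fun j hj => hf j (Finset.mem_of_mem_erase hj)) h)

end QMData

end PositiveCone

theorem List.eq_filter_lt_append_cons {α : Type*} [LinearOrder α] {L : List α}
    (hL : L.Pairwise (· < ·)) {a : α} (ha : a ∈ L) :
    L = L.filter (· < a) ++ a :: L.filter (a < ·) := by
  obtain ⟨s, t, rfl⟩ := List.append_of_mem ha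
  obtain ⟨-, ht, hst⟩ := List.pairwise_append.1 hL
  have hs (b) (hb : b ∈ s) : b < a := hst b hb a (List.mem_cons_self ..)
  have ht (b) (hb : b ∈ t) : a < b := (List.pairwise_cons.1 ht).1 b hb
  have h1 : s.filter (· < a) = s := List.filter_eq_self.2 fun b hb => by simpa using hs b hb
  have h2 : t.filter (· < a) = [] :=
    List.filter_eq_nil_iff.2 fun b hb => by simpa using (ht b hb).le
  have h3 : s.filter (a < ·) = [] :=
    List.filter_eq_nil_iff.2 fun b hb => by simpa using (hs b hb).le
  have h4 : t.filter (a < ·) = t := List.filter_eq_self.2 fun b hb => by simpa using ht b hb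
  simp [List.filter_append, h1, h2, h3, h4]

theorem SkewCommute.exists_zpow_prod_map {K A α : Type*} [Field K] [Ring A] [Algebra K A] {q : K}
    (hq : q ≠ 0) {w : A} {f : α → A} {L : List α}
    (h : ∀ b ∈ L, ∃ e : ℤ, SkewCommute (q ^ e) w (f b)) :
    ∃ e : ℤ, SkewCommute (q ^ e) w (L.map f).prod := by
  induction L with
  | nil => exact ⟨0, by simp [SkewCommute]⟩
  | cons b L ih =>
    obtain ⟨e, he⟩ := h b (List.mem_cons_self ..)
    obtain ⟨e', he'⟩ := ih fun c hc => h c (List.mem_cons_of_mem _ hc)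
    refine ⟨e + e', ?_⟩
    rw [zpow_add₀ hq, List.map_cons, List.prod_cons]
    exact he.mul_right he'

theorem IsQuantumExterior.exists_wt_skew_pathOp {K A : Type*} [Field K] [Ring A] [Algebra K A]
    {m n : ℕ} {white : Fin m → Fin n → Bool} {D : QMData A m n} {q : K} {x : Fin n → A}
    (hx : IsQuantumExterior D q x) {u v y : CVertex m n} (he : CEdge white u v)
    (hy : y.column < n)
    (h : u.level < y.level ∨ u.level = y.level ∧ y.column ≤ v.column) :
    ∃ e : ℤ, SkewCommute (q ^ e) (wt D u v) (pathOp D white x y) := by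
  have hq := hx.q_ne_zero
  have ht (i : Fin m) (j : Fin n) (hij : (i : ℕ) < y.level ∨ (i : ℕ) = y.level ∧ y.column ≤ j) :
      ∃ e : ℤ, SkewCommute (q ^ e) (D.t i j : A) (pathOp D white x y) := by
    have := hx.t_skew_pathOp (white := white) i j y hy hij
    split_ifs at this
    · exact ⟨-1, by simpa using this⟩
    · exact ⟨0, by simpa using this⟩
  cases he with
  | fromRow i l _ _ => simpa [wt] using ht i l h
  | toCol i j _ _ => exact ⟨0, by simpa [wt] using SkewCommute.one_left (K := K) _⟩
  | vert i i' j hi _ _ _ =>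
    exact ⟨0, by simpa [wt] using SkewCommute.one_left (K := K) _⟩
  | horiz i l j hjl _ _ _ =>
    simp only [CVertex.level_sq, CVertex.column_sq] at h
    obtain ⟨e, h1⟩ := ht i l (by omega)
    obtain ⟨e', h2⟩ := ht i j h
    refine ⟨-e + e', ?_⟩
    rw [zpow_add₀ hq, zpow_neg]
    simpa [wt, hjl] using (h1.units_inv_left (zpow_ne_zero _ hq)).mul_left h2

theorem CEdge.exists_wt_eq {R : Type*} [Ring R] {m n : ℕ} {white : Fin m → Fin n → Bool}
    (D : QMData R m n) {u v : CVertex m n} (he : CEdge white u v) :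
    ∃ g ∈ D.monomialGroup, wt D u v = ↑g := by
  cases he with
  | fromRow i l _ _ => exact ⟨_, D.t_mem_monomialGroup i l, by simp [wt]⟩
  | toCol i j _ _ => exact ⟨1, one_mem _, by simp [wt]⟩
  | vert i i' j hi _ _ _ => exact ⟨1, one_mem _, by simp [wt]⟩
  | horiz i l j hjl _ _ _ =>
    exact ⟨_, mul_mem (inv_mem (D.t_mem_monomialGroup i l)) (D.t_mem_monomialGroup i j),
      by simp [wt, hjl]⟩

section Nested

variable {m n k : ℕ} {white : Fin m → Fin n → Bool} {u : Fin k → CVertex m n}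

/-- A family of vertices in which each vertex lies to the left of all later ones, except that row
vertices are ordered from top to bottom. -/
structure IsNested (white : Fin m → Fin n → Bool) (u : Fin k → CVertex m n) : Prop where
  isAdmissible : ∀ a, (u a).IsAdmissible white
  leftOf_or_row : ∀ a b, a < b →
    LeftOf white (u a) (u b) ∨ ∃ i i', u a = .row i ∧ u b = .row i' ∧ i < i'

namespace IsNested

theorem ne (h : IsNested white u) {a b : Fin k} (hab : a ≠ b) : u a ≠ u b := by
  wlog hlt : a < b generalizing a b
  · exact (this hab.symm (lt_of_le_of_ne (not_lt.1 hlt) hab.symm)).symm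
  rcases h.leftOf_or_row a b hlt with hl | ⟨i, i', ha, hb, hi⟩
  · exact fun heq => hl.1.ne (by rw [heq])
  · rw [ha, hb]
    simpa using hi.ne

theorem leftOf_of_before (h : IsNested white u) {a b : Fin k} (hba : b < a)
    (hb : (u a).Before (u b)) : LeftOf white (u b) (u a) := by
  rcases h.leftOf_or_row b a hba with hl | ⟨i, i', hi, hi', hlt⟩
  · exact hl
  · rw [hi, hi'] at hb
    simp only [CVertex.Before, CVertex.level_row, CVertex.column_row] at hb
    omega

theorem leftOf_of_edge (h : IsNested white u) {a b : Fin k} {v : CVertex m n} (hab : a < b)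
    (hb : (u a).Before (u b)) (he : CEdge white (u a) v) : LeftOf white v (u b) := by
  rcases h.leftOf_or_row a b hab with hl | ⟨i, i', hi, hi', hlt⟩
  · exact hl.of_edge_left hb he
  · rw [hi] at he
    rw [hi']
    cases he with
    | fromRow _ j _ _ =>
      exact ⟨j.isLt, fun hlt' => absurd hlt' (by simpa using hlt.le)⟩

theorem column_le_of_edge (h : IsNested white u) (hC : IsCauchon white) {a b : Fin k}
    {v : CVertex m n} (hba : b < a) (hb : (u a).Before (u b)) (he : CEdge white (u a) v) :
    (u b).column ≤ v.column := by
  by_cases hv : v = u b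
  · rw [hv]
  · exact ((h.leftOf_of_before hba hb).of_edge_right hC (h.isAdmissible b) hb he hv).1.le

theorem update (h : IsNested white u) (hC : IsCauchon white) {a : Fin k} {v : CVertex m n}
    (hmin : ∀ b, b ≠ a → (u a).Before (u b)) (he : CEdge white (u a) v)
    (hv : ∀ b, b ≠ a → u b ≠ v) : IsNested white (Function.update u a v) where
  isAdmissible b := by
    by_cases hb : b = a
    · subst hb
      simpa using he.isAdmissible
    · simpa [hb] using h.isAdmissible b
  leftOf_or_row b c hbc := by
    by_cases hb : b = a
    · subst hb
      simpa [hbc.ne'] using .inl (h.leftOf_of_edge hbc (hmin c hbc.ne') he)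
    · by_cases hc : c = a
      · subst hc
        simpa [hb] using .inl ((h.leftOf_of_before hbc (hmin b hb)).of_edge_right hC
          (h.isAdmissible b) (hmin b hb) he (hv b hb).symm)
      · simpa [hb, hc] using h.leftOf_or_row b c hbc

theorem lt_and_not_between (h : IsNested white u) (hC : IsCauchon white) {a b : Fin k}
    (hmin : ∀ c, c ≠ a → (u a).Before (u c)) (hba : b ≠ a) (he : CEdge white (u a) (u b)) :
    b < a ∧ ∀ c, b < c → ¬ c < a := by
  have hlt : b < a := by
    by_contra hlt
    have hab : a < b := lt_of_le_of_ne (not_lt.1 hlt) hba.symm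
    exact lt_irrefl _ (h.leftOf_of_edge hab (hmin b hba) he).1
  refine ⟨hlt, fun c hbc hca => ?_⟩
  have hcol := he.column_lt
  rcases h.leftOf_or_row b c hbc with hl | ⟨i, i', hi, -⟩
  · exact (h.leftOf_of_before hca (hmin c hca.ne)).not_between hC hl (h.isAdmissible c)
      (hmin c hca.ne) he
  · rw [hi] at hcol
    exact lt_irrefl _ hcol

theorem exists_before (h : IsNested white u) (hcol : ∃ a, ∀ j, u a ≠ .col j) :
    ∃ a, (∀ j, u a ≠ .col j) ∧ ∀ b, b ≠ a → (u a).Before (u b) := by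
  obtain ⟨a₀, ha₀⟩ := hcol
  obtain ⟨a, -, ha⟩ := Finset.exists_max_image Finset.univ (fun a => (u a).depth)
    ⟨a₀, Finset.mem_univ _⟩
  refine ⟨a, fun j hj => ?_, fun b hb =>
    CVertex.before_of_depth_le (ha b (Finset.mem_univ _)) (h.ne hb.symm)⟩
  have hlt : (u a₀).Before (u a) := by
    left
    rw [hj, CVertex.level_col]
    cases hu : u a₀ with
    | col j => exact absurd hu (ha₀ j)
    | row i => exact i.isLt
    | sq i j => exact i.isLt
  exact absurd hlt.depth_lt (not_lt.2 (ha a₀ (Finset.mem_univ _)))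

end IsNested

theorem not_hasDisjointPaths_of_eq {κ : Fin k → Fin n} {a b : Fin k} (hab : a ≠ b)
    (h : u a = u b) : ¬ HasDisjointPaths white κ u := by
  rintro ⟨σ, P, hP, hdisj⟩
  have ha := List.mem_of_mem_head? (hP a).2.1
  have hb := List.mem_of_mem_head? (hP b).2.1
  rw [h] at ha
  exact hdisj a b hab ha hb

end Nested

section Main

variable {K R : Type*} [Field K] [Ring R] [Algebra K R] {m n k : ℕ}
  {white : Fin m → Fin n → Bool} {D : QMData R m n} {q : K}

/-- The coefficient at `S` of the product of the path generating elements of a family of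
vertices. -/
noncomputable def exteriorCoeff (white : Fin m → Fin n → Bool) (hq : (D.q : R) = algebraMap K R q)
    (S : Finset (Fin n)) (u : Fin k → CVertex m n) : R :=
  ((List.finRange k).map fun a => pathOp (D.onExterior q hq) white
    (fun l => creationOp q (Pi.single l 1)) (u a)).prod (Pi.single ∅ 1) S

theorem exteriorCoeff_eq_zero_of_eq (hC : IsCauchon white) (hq : (D.q : R) = algebraMap K R q)
    (hq0 : q ≠ 0) (S : Finset (Fin n)) {u : Fin k → CVertex m n} {a b : Fin k} (hba : b < a)
    (hbetween : ∀ c, b < c → ¬ c < a) (h : u b = u a) (hcol : (u a).column < n)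
    (hadm : (u a).IsAdmissible white) : exteriorCoeff white hq S u = 0 := by
  have hsq := ((D.isQuantumExterior_onExterior q hq hq0).pathOp_skew_and_mul_self hC (u a) (u a)
    hcol hcol hadm hadm).2 rfl
  have hsorted := List.pairwise_lt_finRange k
  have hnil : ((List.finRange k).filter (· < a)).filter (b < ·) = [] := by
    simpa [List.filter_eq_nil_iff] using hbetween
  rw [exteriorCoeff, List.eq_filter_lt_append_cons hsorted (List.mem_finRange a),
    List.eq_filter_lt_append_cons (L := (List.finRange k).filter (· < a)) (a := b)
      (hsorted.filter _) (by simpa using hba), hnil]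
  simp only [List.map_append, List.map_cons, List.map_nil, List.prod_append, List.prod_cons,
    List.prod_nil, mul_one, mul_assoc, h]
  rw [← mul_assoc (pathOp _ _ _ (u a)) (pathOp _ _ _ (u a)), hsq]
  simp

theorem exteriorCoeff_eq_sum (hC : IsCauchon white) (hq : (D.q : R) = algebraMap K R q)
    (hq0 : q ≠ 0) (S : Finset (Fin n)) {u : Fin k → CVertex m n} (hu : IsNested white u)
    {a : Fin k} (hcol : ∀ j, u a ≠ .col j) (hmin : ∀ b, b ≠ a → (u a).Before (u b)) :
    ∃ e : CVertex m n → ℤ, exteriorCoeff white hq S u =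
      ∑ v ∈ outNbrs white (u a),
        q ^ e v • (wt D (u a) v * exteriorCoeff white hq S (Function.update u a v)) := by
  have hx := D.isQuantumExterior_onExterior q hq hq0
  have hsplit := List.eq_filter_lt_append_cons (List.pairwise_lt_finRange k) (List.mem_finRange a)
  set L₁ := (List.finRange k).filter (· < a) with hL₁
  set L₂ := (List.finRange k).filter (a < ·) with hL₂
  set op := pathOp (D.onExterior q hq) white (fun l => creationOp q (Pi.single l (1 : R))) with hop
  have hterm (v : CVertex m n) : ∃ e : ℤ, v ∈ outNbrs white (u a) →
      ((L₁.map fun b => op (u b)).prod * (wt (D.onExterior q hq) (u a) v * op v *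
          (L₂.map fun b => op (u b)).prod)) (Pi.single ∅ 1) S =
        q ^ e • (wt D (u a) v * exteriorCoeff white hq S (Function.update u a v)) := by
    by_cases hv : v ∈ outNbrs white (u a)
    swap
    · exact ⟨0, fun h => absurd h hv⟩
    have he := mem_outNbrs.1 hv
    obtain ⟨e, hskew⟩ := SkewCommute.exists_zpow_prod_map (L := L₁) (f := fun b => op (u b)) hq0
      (w := wt (D.onExterior q hq) (u a) v) fun b hb => by
        have hba : b < a := by simpa [hL₁] using hb
        have hb := hmin b hba.ne
        have hcol := hu.column_le_of_edge hC hba hb he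
        refine hx.exists_wt_skew_pathOp he (hcol.trans_lt he.column_lt) ?_
        unfold CVertex.Before at hb
        omega
    obtain ⟨e₁, he₁⟩ := CVertex.scale_eq_zpow q S (u a)
    obtain ⟨e₂, he₂⟩ := CVertex.scale_eq_zpow q S v
    refine ⟨-e + (-e₁ + e₂), fun _ => ?_⟩
    have hupd : exteriorCoeff white hq S (Function.update u a v) =
        ((L₁.map fun b => op (u b)).prod * (op v * (L₂.map fun b => op (u b)).prod))
          (Pi.single ∅ 1) S := by
      have h₁ : (L₁.map fun b => op (Function.update u a v b)) = L₁.map fun b => op (u b) :=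
        List.map_congr_left fun b hb => by
          have hba : b < a := by simpa [hL₁] using hb
          rw [Function.update_of_ne hba.ne]
      have h₂ : (L₂.map fun b => op (Function.update u a v b)) = L₂.map fun b => op (u b) :=
        List.map_congr_left fun b hb => by
          have hba : a < b := by simpa [hL₂] using hb
          rw [Function.update_of_ne hba.ne']
      rw [exteriorCoeff, ← hop, hsplit, List.map_append, List.map_cons, List.prod_append,
        List.prod_cons, h₁, h₂, Function.update_self]
    have hmove := hskew.symm (zpow_ne_zero _ hq0)
    rw [SkewCommute] at hmove
    rw [mul_assoc (wt _ _ _), ← mul_assoc, hmove, smul_mul_assoc, mul_assoc (wt _ _ _),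
      LinearMap.smul_apply, Pi.smul_apply, Module.End.mul_apply,
      D.wt_onExterior_apply q hq hq0 he, ← hupd, he₁, he₂, smul_smul, zpow_add₀ hq0, zpow_add₀ hq0,
      zpow_neg, zpow_neg]
  choose e he using hterm
  refine ⟨e, ?_⟩
  rw [← Finset.sum_congr rfl fun v hv => he v hv, exteriorCoeff, ← hop, hsplit, List.map_append,
    List.map_cons, List.prod_append, List.prod_cons]
  rw [hop, pathOp_eq_sum _ _ hcol, ← hop, Finset.sum_mul, Finset.mul_sum, LinearMap.sum_apply,
    Finset.sum_apply]

theorem exteriorCoeff_mem_and_ne_zero_iff [CharZero K] (hC : IsCauchon white)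
    (hq : (D.q : R) = algebraMap K R q) (hqtr : Transcendental ℚ q)
    (hlin : LinearIndependent K (lexMonomial D)) (κ : Fin k → Fin n) {u : Fin k → CVertex m n}
    (hu : IsNested white u) :
    exteriorCoeff white hq (Finset.univ.image κ) u ∈ D.positiveCone ∧
      (exteriorCoeff white hq (Finset.univ.image κ) u ≠ 0 ↔ HasDisjointPaths white κ u) := by
  have hq0 : q ≠ 0 := by
    rintro rfl
    exact hqtr isAlgebraic_zero
  induction hd : ∑ a, (u a).depth using Nat.strong_induction_on generalizing u with
  | _ d ih =>
  by_cases hcol : ∃ a, ∀ j, u a ≠ .col j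
  · obtain ⟨a, hcol, hmin⟩ := hu.exists_before hcol
    have key (v) (hv : v ∈ outNbrs white (u a)) :
        exteriorCoeff white hq (Finset.univ.image κ) (Function.update u a v) ∈ D.positiveCone ∧
          (exteriorCoeff white hq (Finset.univ.image κ) (Function.update u a v) ≠ 0 ↔
            HasDisjointPaths white κ (Function.update u a v)) := by
      have he := mem_outNbrs.1 hv
      by_cases hvu : ∃ b, b ≠ a ∧ u b = v
      · obtain ⟨b, hba, rfl⟩ := hvu
        obtain ⟨hlt, hbetween⟩ := hu.lt_and_not_between hC hmin hba he
        have heq : Function.update u a (u b) b = Function.update u a (u b) a := by simp [hba]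
        rw [exteriorCoeff_eq_zero_of_eq hC hq hq0 _ hlt hbetween heq (by simpa using he.column_lt)
          (by simpa using he.isAdmissible)]
        exact ⟨zero_mem _, by simpa using not_hasDisjointPaths_of_eq hba heq⟩
      · have hv' : ∀ b, b ≠ a → u b ≠ v := fun b hb h => hvu ⟨b, hb, h⟩
        refine ih _ ?_ (hu.update hC hmin he hv') rfl
        rw [← hd]
        refine Finset.sum_lt_sum (fun b _ => ?_) ⟨a, Finset.mem_univ _, ?_⟩
        · by_cases hb : b = a
          · subst hb
            simpa using he.before.depth_lt.le
          · simp [hb]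
        · simpa using he.before.depth_lt
    obtain ⟨e, hsum⟩ := exteriorCoeff_eq_sum hC hq hq0 (Finset.univ.image κ) hu hcol hmin
    have hmem (v) (hv : v ∈ outNbrs white (u a)) :
        q ^ e v • (wt D (u a) v * exteriorCoeff white hq (Finset.univ.image κ)
          (Function.update u a v)) ∈ D.positiveCone := by
      obtain ⟨g, hg, hw⟩ := (mem_outNbrs.1 hv).exists_wt_eq D
      rw [hw]
      exact QMData.smul_mem_positiveCone hq hq0 _ (D.mul_mem_positiveCone hg (key v hv).1)
    rw [hsum]
    refine ⟨sum_mem hmem, ?_⟩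
    rw [QMData.sum_mem_positiveCone_ne_zero_iff hq hqtr hlin hmem,
      hasDisjointPaths_iff_exists_update hcol hmin]
    refine exists_congr fun v => and_congr_right fun hv => ?_
    obtain ⟨g, -, hw⟩ := (mem_outNbrs.1 hv).exists_wt_eq D
    rw [← (key v hv).2, hw, ne_eq, smul_eq_zero_iff_right (zpow_ne_zero _ hq0),
      Units.mul_right_eq_zero]
  · push Not at hcol
    choose c hc using hcol
    obtain rfl : u = fun a => .col (c a) := funext hc
    have hmono : StrictMono c := fun a b hab => by
      rcases hu.leftOf_or_row a b hab with h | ⟨_, _, h, _⟩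
      · exact h.1
      · cases h
    have : Nontrivial R := ⟨_, _, hlin.ne_zero 0⟩
    rw [hasDisjointPaths_col_iff hmono.injective, exists_perm_comp_iff hmono.injective]
    simp only [exteriorCoeff, pathOp_col]
    rw [prod_creationOp_single_apply q hmono]
    split_ifs with h
    · exact ⟨D.one_mem_positiveCone, by simp [h]⟩
    · exact ⟨zero_mem _, by simp [h]⟩

end Main

/-- over a `K`-algebra with `q` the image of a nonzero element of
`K` transcendental over `ℚ`, and with linearly independent ordered monomials,
`det_q(M_C[I,J]) = 0` iff no vertex-disjoint `(R_I, C_J)`-path system exists. -/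
theorem qdet_eq_zero_iff_no_disjoint_system {K : Type*} {R : Type u}
    [Field K] [CharZero K] [Ring R] [Algebra K R]
    {m n : ℕ} (D : QMData R m n) (white : Fin m → Fin n → Bool) (hC : IsCauchon white)
    (qK : K) (hq0 : qK ≠ 0) (hqtr : Transcendental ℚ qK)
    (hq : (D.q : R) = algebraMap K R qK)
    (hlin : LinearIndependent K fun r : Fin m × Fin n → ℤ => lexMonomial D r)
    {k : ℕ} (ι : Fin k → Fin m) (κ : Fin k → Fin n)
    (hι : StrictMono ι) (hκ : StrictMono κ) :
    qdet D.q (Matrix.of fun a b : Fin k => pathMatrix D white (ι a) (κ b)) = 0 ↔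
      ¬ ∃ S : PathSys white ι κ, S.VertexDisjoint := by
  have hnested : IsNested white fun a => (.row (ι a) : CVertex m n) :=
    ⟨fun _ => trivial, fun a b hab => .inr ⟨ι a, ι b, rfl, rfl, hι hab⟩⟩
  have hcoeff := (exteriorCoeff_mem_and_ne_zero_iff hC hq hqtr hlin κ hnested).2
  simp only [exteriorCoeff, D.pathOp_onExterior_row qK hq hq0] at hcoeff
  rw [prod_creationOp_apply_eq_qdet hq _ hκ] at hcoeff
  rw [exists_vertexDisjoint_iff, ← hcoeff, not_not]
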